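/- Every product ∏_{t∈T} L_t (over an arbitrary index set T) of simple, connected and simply connected compact Lie groups is an AE(3)-compactum. -/

import Mathlib

open Topology

universe u

/-- A topological space `Z` has Lebesgue covering dimension at most `n`:
every finite open cover admits a finite open refinement in which each point
lies in at most `n + 1` members. -/
def CovDimLE (Z : Type u) [TopologicalSpace Z] (n : ℕ) : Prop :=
  ∀ 𝒰 : Finset (Set Z), (∀ U ∈ 𝒰, IsOpen U) → ⋃₀ (𝒰 : Set (Set Z)) = Set.univ →
    ∃ 𝒱 : Finset (Set Z), (∀ V ∈ 𝒱, IsOpen V) ∧ ⋃₀ (𝒱 : Set (Set Z)) = Set.univ ∧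
      (∀ V ∈ 𝒱, ∃ U ∈ 𝒰, V ⊆ U) ∧
      ∀ z : Z, Nat.card {V : Set Z // V ∈ 𝒱 ∧ z ∈ V} ≤ n + 1

/-- `X` is an absolute extensor in dimension `n` (an AE(n)-space): every continuous map
into `X` from a closed subspace of a compact Hausdorff space of covering dimension
at most `n` extends continuously over the whole space. -/
def IsAE (n : ℕ) (X : Type u) [TopologicalSpace X] : Prop :=
  ∀ (Z : Type u) [TopologicalSpace Z], CompactSpace Z → T2Space Z → CovDimLE Z n →
    ∀ Z₀ : Set Z, IsClosed Z₀ → ∀ g₀ : C(Z₀, X),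
      ∃ g : C(Z, X), ∀ z : Z₀, g (z : Z) = g₀ z

/-- `X` is an absolute neighborhood extensor in dimension `4` (an ANE(4)-space):
every continuous map into `X` from a closed subspace `Z₀` of a compact Hausdorff
space of covering dimension at most `4` extends continuously over some open
neighborhood of `Z₀`. -/
def IsANE4 (X : Type u) [TopologicalSpace X] : Prop :=
  ∀ (Z : Type u) [TopologicalSpace Z], CompactSpace Z → T2Space Z → CovDimLE Z 4 →
    ∀ Z₀ : Set Z, IsClosed Z₀ → ∀ g₀ : C(Z₀, X),
      ∃ (U : Set Z) (_ : IsOpen U) (hZ₀U : Z₀ ⊆ U) (g : C(U, X)),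
        ∀ (z : Z) (hz : z ∈ Z₀), g ⟨z, hZ₀U hz⟩ = g₀ ⟨z, hz⟩

/-- The underlying space of `X` is a topological manifold: every point has an open
neighborhood homeomorphic to an open subset of some Euclidean space. -/
def IsTopManifold (X : Type u) [TopologicalSpace X] : Prop :=
  ∀ x : X, ∃ (n : ℕ) (U : Set X) (V : Set (EuclideanSpace ℝ (Fin n))),
    IsOpen U ∧ x ∈ U ∧ IsOpen V ∧ Nonempty (U ≃ₜ V)

/-- The multiplicative equivalence `e` is an isomorphism of topological groups,
i.e. it is continuous with continuous inverse. -/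
def IsTopGroupIso {G H : Type*} [Group G] [Group H] [TopologicalSpace G]
    [TopologicalSpace H] (e : G ≃* H) : Prop :=
  Continuous e ∧ Continuous e.symm

/-- A package consisting of a compact Hausdorff topological group. -/
structure CompactGroupPkg : Type (u + 1) where
  carrier : Type u
  [topology : TopologicalSpace carrier]
  [group : Group carrier]
  [topGroup : IsTopologicalGroup carrier]
  [compact : CompactSpace carrier]
  [t2 : T2Space carrier]

attribute [instance] CompactGroupPkg.topology CompactGroupPkg.group
  CompactGroupPkg.topGroup CompactGroupPkg.compact CompactGroupPkg.t2

/-- `L` is a simple, connected and simply connected compact Lie group: a compact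
Hausdorff topological group whose underlying space is a topological manifold,
which is connected, simply connected, nonabelian, and all of whose closed
normal subgroups other than the whole group are finite. -/
def IsSimpleSCSCLieGroup (L : CompactGroupPkg.{u}) : Prop :=
  IsTopManifold L.carrier ∧ ConnectedSpace L.carrier ∧ SimplyConnectedSpace L.carrier ∧
    (∃ a b : L.carrier, a * b ≠ b * a) ∧
    ∀ N : Subgroup L.carrier, N.Normal → IsClosed (N : Set L.carrier) → N ≠ ⊤ → Finite N

set_option linter.unusedSectionVars false
set_option linter.overlappingInstances false

namespace SimpleLie

open Filter Set
open NormedSpace (exp)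

section ExpReal

variable {A : Type*} [NormedRing A] [NormedAlgebra ℝ A] [CompleteSpace A]

theorem continuous_exp : Continuous (exp : A → A) := by
  let +nondep : NormedAlgebra ℚ A := .restrictScalars ℚ ℝ A
  exact NormedSpace.exp_continuous

theorem exp_add_of_commute {x y : A} (h : Commute x y) : exp (x + y) = exp x * exp y := by
  let +nondep : NormedAlgebra ℚ A := .restrictScalars ℚ ℝ A
  exact NormedSpace.exp_add_of_commute h

theorem exp_mul_exp_neg (x : A) : exp x * exp (-x) = 1 := by
  rw [← exp_add_of_commute (Commute.refl x).neg_right, add_neg_cancel, NormedSpace.exp_zero]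

theorem exp_neg_mul_exp (x : A) : exp (-x) * exp x = 1 := by
  rw [← exp_add_of_commute (Commute.refl x).neg_left, neg_add_cancel, NormedSpace.exp_zero]

theorem exp_natCast_smul (n : ℕ) (x : A) : exp ((n : ℝ) • x) = exp x ^ n := by
  let +nondep : NormedAlgebra ℚ A := .restrictScalars ℚ ℝ A
  rw [Nat.cast_smul_eq_nsmul]
  exact NormedSpace.exp_nsmul n x

theorem exp_conj {u v : A} (huv : u * v = 1) (hvu : v * u = 1) (x : A) :
    exp (u * x * v) = u * exp x * v := by
  let +nondep : NormedAlgebra ℚ A := .restrictScalars ℚ ℝ A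
  exact NormedSpace.exp_units_conj (⟨u, v, huv, hvu⟩ : Aˣ) x

theorem exp_hasStrictFDerivAt_zero :
    HasStrictFDerivAt (exp : A → A) ((ContinuousLinearEquiv.refl ℝ A : A ≃L[ℝ] A) : A →L[ℝ] A) 0 :=
  _root_.hasStrictFDerivAt_exp_zero (𝕂 := ℝ)

theorem contDiff_exp {n : WithTop ℕ∞} : ContDiff ℝ n (exp : A → A) :=
  contDiff_iff_contDiffAt.2 fun x => (NormedSpace.exp_analytic (𝕂 := ℝ) x).contDiffAt

/-- A local logarithm near `1`. -/
noncomputable def logA : A → A :=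
  (exp_hasStrictFDerivAt_zero (A := A)).localInverse exp _ 0

theorem exp_logA : ∀ᶠ a in 𝓝 (1 : A), exp (logA a) = a := by
  have := (exp_hasStrictFDerivAt_zero (A := A)).eventually_right_inverse
  rwa [NormedSpace.exp_zero] at this

theorem logA_exp : ∀ᶠ x in 𝓝 (0 : A), logA (exp x) = x :=
  (exp_hasStrictFDerivAt_zero (A := A)).eventually_left_inverse

theorem logA_one : logA (1 : A) = 0 := by
  have := (exp_hasStrictFDerivAt_zero (A := A)).localInverse_apply_image
  rwa [NormedSpace.exp_zero] at this

theorem hasFDerivAt_logA :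
    HasFDerivAt (logA : A → A) ((ContinuousLinearEquiv.refl ℝ A : A ≃L[ℝ] A) : A →L[ℝ] A) 1 := by
  have := (exp_hasStrictFDerivAt_zero (A := A)).to_localInverse.hasFDerivAt
  rwa [NormedSpace.exp_zero] at this

theorem continuousAt_logA : ContinuousAt (logA : A → A) 1 :=
  hasFDerivAt_logA.continuousAt

end ExpReal

section LieAlgebra

variable {A : Type*} [NormedRing A] [NormedAlgebra ℝ A] [CompleteSpace A]
  {G : Type*} [Group G] [TopologicalSpace G] (ρ : G →* A)

theorem map_mul_map_inv (g : G) : ρ g * ρ g⁻¹ = 1 := by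
  rw [← map_mul, mul_inv_cancel, map_one]

theorem map_inv_mul_map (g : G) : ρ g⁻¹ * ρ g = 1 := by
  rw [← map_mul, inv_mul_cancel, map_one]

theorem isClosed_range_rep [CompactSpace G] {ρ : G →* A} (hρ : Continuous ρ) :
    IsClosed (range ρ) :=
  (isCompact_range hρ).isClosed

/-- If `exp x` is in the image of the representation then so is `exp (m x)`, `m ∈ ℤ`. -/
theorem exp_intCast_smul_mem {ρ : G →* A} {x : A} (hx : exp x ∈ range ρ) (m : ℤ) :
    exp ((m : ℝ) • x) ∈ range ρ := by
  obtain ⟨g, hg⟩ := hx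
  obtain ⟨n, rfl | rfl⟩ := m.eq_nat_or_neg
  · refine ⟨g ^ n, ?_⟩
    rw [Int.cast_natCast, exp_natCast_smul, map_pow, hg]
  · refine ⟨g⁻¹ ^ n, ?_⟩
    have h1 : exp (-x) = ρ g⁻¹ := by
      calc exp (-x) = exp (-x) * (ρ g * ρ g⁻¹) := by rw [map_mul_map_inv, mul_one]
        _ = ρ g⁻¹ := by rw [← mul_assoc, hg, exp_neg_mul_exp, one_mul]
    rw [Int.cast_neg, Int.cast_natCast, neg_smul, ← smul_neg, exp_natCast_smul, map_pow, h1]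

/-- The set of velocities of one-parameter subgroups. -/
def lieSet : Set A := {X | ∀ t : ℝ, exp (t • X) ∈ range ρ}

/-- Limits of rescaled displacements inside the group are velocities. -/
theorem mem_lieSet_of_tendsto [CompactSpace G] {ρ : G →* A} (hρ : Continuous ρ)
    {ι : Type*} {l : Filter ι} [l.NeBot] {a : ι → A} {c : ι → ℝ} {X : A}
    (ha : ∀ᶠ i in l, a i ∈ range ρ) (ha1 : Tendsto a l (𝓝 1))
    (hc : Tendsto (fun i => c i • (a i - 1)) l (𝓝 X)) : X ∈ lieSet ρ := by
  intro t
  set x : ι → A := fun i => logA (a i) with hx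
  have hx0 : Tendsto x l (𝓝 0) := by
    have := continuousAt_logA.tendsto.comp ha1
    rwa [logA_one] at this
  have hexp : ∀ᶠ i in l, exp (x i) = a i := ha1.eventually exp_logA
  have hlog : Tendsto (fun i => c i • x i) l (𝓝 X) := by
    have h1 : (fun i => x i - (a i - 1)) =o[l] fun i => a i - 1 := by
      have := (hasFDerivAt_logA (A := A)).isLittleO.comp_tendsto ha1
      simpa [Function.comp_def, logA_one, hx] using this
    have h2 : (fun i => c i • (x i - (a i - 1))) =o[l] fun i => c i • (a i - 1) :=
      (Asymptotics.isBigO_refl c l).smul_isLittleO h1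
    have h3 : Tendsto (fun i => c i • (x i - (a i - 1))) l (𝓝 0) :=
      (h2.trans_isBigO (hc.isBigO_one ℝ)).tendsto_zero_of_tendsto tendsto_const_nhds
    have := h3.add hc
    rw [zero_add] at this
    refine this.congr fun i => ?_
    rw [← smul_add, sub_add_cancel]
  have hfl : Tendsto (fun i => ((⌊t * c i⌋ : ℤ) : ℝ) • x i) l (𝓝 (t • X)) := by
    have h4 : Tendsto (fun i => Int.fract (t * c i) • x i) l (𝓝 0) := by
      refine squeeze_zero_norm (a := fun i => ‖x i‖) (fun i => ?_) ?_
      · rw [norm_smul, Real.norm_of_nonneg (Int.fract_nonneg _)]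
        exact mul_le_of_le_one_left (norm_nonneg _) (Int.fract_lt_one _).le
      · simpa using hx0.norm
    have := (hlog.const_smul t).sub h4
    rw [sub_zero] at this
    refine this.congr fun i => ?_
    rw [smul_smul, ← sub_smul, Int.self_sub_fract]
  refine (isClosed_range_rep hρ).mem_of_tendsto ((continuous_exp.tendsto _).comp hfl) ?_
  filter_upwards [ha, hexp] with i hi hi'
  exact exp_intCast_smul_mem (hi' ▸ hi) _

theorem smul_mem_lieSet {X : A} (hX : X ∈ lieSet ρ) (c : ℝ) : c • X ∈ lieSet ρ := fun t => by
  rw [smul_smul]; exact hX _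

theorem exp_mem_of_mem_lieSet {X : A} (hX : X ∈ lieSet ρ) : exp X ∈ range ρ := by
  simpa using hX 1

theorem zero_mem_lieSet : (0 : A) ∈ lieSet ρ := fun t => ⟨1, by simp [NormedSpace.exp_zero]⟩

/-- The tangent vector at `0` of a differentiable curve in the group is in the Lie algebra. -/
theorem mem_lieSet_of_hasDerivAt [CompactSpace G] {ρ : G →* A} (hρ : Continuous ρ)
    {γ : ℝ → A} {X : A} (hγ : HasDerivAt γ X 0) (h0 : γ 0 = 1) (hr : ∀ s, γ s ∈ range ρ) :
    X ∈ lieSet ρ := by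
  have h := hasDerivAt_iff_tendsto_slope.1 hγ
  refine mem_lieSet_of_tendsto (l := 𝓝[≠] (0:ℝ)) hρ (a := γ) (c := fun s => (s - 0)⁻¹)
    (Eventually.of_forall hr) ?_ ?_
  · have := hγ.continuousAt.tendsto
    rw [h0] at this
    exact this.mono_left nhdsWithin_le_nhds
  · refine h.congr fun s => ?_
    rw [slope, h0, vsub_eq_sub]

theorem hasDerivAt_exp_smul (X : A) : HasDerivAt (fun s : ℝ => exp (s • X)) X 0 := by
  have := hasDerivAt_exp_smul_const (𝕂 := ℝ) X 0
  simpa [NormedSpace.exp_zero] using this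

theorem add_mem_lieSet [CompactSpace G] {ρ : G →* A} (hρ : Continuous ρ) {X Y : A}
    (hX : X ∈ lieSet ρ) (hY : Y ∈ lieSet ρ) : X + Y ∈ lieSet ρ := by
  refine mem_lieSet_of_hasDerivAt hρ (γ := fun s : ℝ => exp (s • X) * exp (s • Y)) ?_ ?_ ?_
  · have := (hasDerivAt_exp_smul X).fun_mul (hasDerivAt_exp_smul Y)
    simpa [NormedSpace.exp_zero] using this
  · simp [NormedSpace.exp_zero]
  · intro s
    obtain ⟨g, hg⟩ := hX s
    obtain ⟨h, hh⟩ := hY s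
    exact ⟨g * h, by rw [map_mul, hg, hh]⟩

/-- The Lie algebra of a compact group represented in a finite dimensional algebra. -/
def lieSub [CompactSpace G] {ρ : G →* A} (hρ : Continuous ρ) : Submodule ℝ A where
  carrier := lieSet ρ
  add_mem' := add_mem_lieSet hρ
  zero_mem' := zero_mem_lieSet ρ
  smul_mem' c _ hX := smul_mem_lieSet ρ hX c

theorem conj_mem_lieSet {X : A} (hX : X ∈ lieSet ρ) (g : G) : ρ g * X * ρ g⁻¹ ∈ lieSet ρ := by
  intro t
  obtain ⟨h, hh⟩ := hX t
  refine ⟨g * h * g⁻¹, ?_⟩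
  rw [← smul_mul_assoc, ← mul_smul_comm, exp_conj (map_mul_map_inv ρ g) (map_inv_mul_map ρ g),
    map_mul, map_mul, hh]

theorem commutator_mem_lieSub [CompactSpace G] [FiniteDimensional ℝ A]
    {ρ : G →* A} (hρ : Continuous ρ) {X Y : A}
    (hX : X ∈ lieSub hρ) (hY : Y ∈ lieSub hρ) : X * Y - Y * X ∈ lieSub hρ := by
  have hd : HasDerivAt (fun s : ℝ => exp (s • X) * Y * exp (s • (-X))) (X * Y - Y * X) 0 := by
    have := ((hasDerivAt_exp_smul X).mul_const Y).fun_mul (hasDerivAt_exp_smul (-X))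
    simpa [NormedSpace.exp_zero, sub_eq_add_neg] using this
  have h := hasDerivAt_iff_tendsto_slope.1 hd
  have hcl : IsClosed (lieSub hρ : Set A) := Submodule.closed_of_finiteDimensional _
  refine hcl.mem_of_tendsto h (Eventually.of_forall fun s => ?_)
  have hs : ∀ s : ℝ, exp (s • X) * Y * exp (s • (-X)) ∈ lieSub hρ := fun s => by
    obtain ⟨g, hg⟩ := hX s
    have hg' : exp (s • (-X)) = ρ g⁻¹ := by
      calc exp (s • (-X)) = exp (-(s • X)) * (ρ g * ρ g⁻¹) := by
            rw [map_mul_map_inv, mul_one, smul_neg]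
        _ = ρ g⁻¹ := by rw [← mul_assoc, hg, exp_neg_mul_exp, one_mul]
    rw [← hg, hg']
    exact conj_mem_lieSet ρ hY g
  rw [slope, vsub_eq_sub]
  exact (lieSub hρ).smul_mem _ ((lieSub hρ).sub_mem (hs _) (hs _))

end LieAlgebra

section Charts

variable {A : Type*} [NormedRing A] [NormedAlgebra ℝ A] [CompleteSpace A] [FiniteDimensional ℝ A]
  {G : Type*} [Group G] [TopologicalSpace G] [CompactSpace G]
  {ρ : G →* A} (hρ : Continuous ρ)

theorem isClosedEmbedding_rep (hρ : Continuous ρ) (hinj : Function.Injective ρ) : IsClosedEmbedding ρ :=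
  hρ.isClosedEmbedding hinj

theorem exists_norm_le_rep (hρ : Continuous ρ) : ∃ M : ℝ, 0 < M ∧ ∀ g, ‖ρ g‖ ≤ M := by
  obtain ⟨M, hM⟩ := (isCompact_range hρ).isBounded.exists_norm_le
  exact ⟨max M 1, by positivity, fun g => (hM _ ⟨g, rfl⟩).trans (le_max_left _ _)⟩

/-- The image of the group is transverse to a complement of the Lie algebra. -/
theorem transversality {n : Submodule ℝ A} (hn : Disjoint (lieSub hρ) n) :
    ∃ ε > 0, ∀ N ∈ n, ‖N‖ < ε → 1 + N ∈ range ρ → N = 0 := by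
  by_contra! hcon
  have : ∀ k : ℕ, ∃ N ∈ n, ‖N‖ < 1 / ((k : ℝ) + 1) ∧ 1 + N ∈ range ρ ∧ N ≠ 0 :=
    fun k => hcon _ (by positivity)
  choose N hNn hNs hNr hN0 using this
  have : ProperSpace A := FiniteDimensional.proper ℝ A
  have hsph : ∀ k, ‖N k‖⁻¹ • N k ∈ Metric.sphere (0 : A) 1 := fun k => by
    rw [mem_sphere_zero_iff_norm, norm_smul, norm_inv, norm_norm,
      inv_mul_cancel₀ (norm_ne_zero_iff.2 (hN0 k))]
  obtain ⟨u, hu, φ, hφ, hlim⟩ := (isCompact_sphere (0 : A) 1).tendsto_subseq hsph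
  have hN : Tendsto N atTop (𝓝 0) := by
    rw [tendsto_zero_iff_norm_tendsto_zero]
    exact squeeze_zero (fun _ => norm_nonneg _) (fun k => (hNs k).le)
      tendsto_one_div_add_atTop_nhds_zero_nat
  have hlie : u ∈ lieSub hρ := by
    refine mem_lieSet_of_tendsto hρ (l := atTop) (a := fun k => 1 + N (φ k))
      (c := fun k => ‖N (φ k)‖⁻¹) (Eventually.of_forall fun k => hNr _) ?_ ?_
    · simpa using (hN.comp hφ.tendsto_atTop).const_add 1
    · simpa [Function.comp_def] using hlim
  have hun : u ∈ n := (Submodule.closed_of_finiteDimensional n).mem_of_tendsto hlim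
    (Eventually.of_forall fun k => n.smul_mem _ (hNn _))
  have h0 : u = 0 := (Submodule.disjoint_def.1 hn) u hlie hun
  rw [h0] at hu
  simp at hu

variable {P : Type*} [NormedAddCommGroup P] [NormedSpace ℝ P] [FiniteDimensional ℝ P]

/-- A tubular neighbourhood map built from a parametrisation of the group near `1`. -/
theorem exists_tubular {φ : P → A} {D : P →L[ℝ] A} (hφ : HasStrictFDerivAt φ D 0) (hφ1 : φ 0 = 1)
    (hD : Function.Injective D) (hDr : LinearMap.range (D : P →ₗ[ℝ] A) = lieSub hρ)
    {n : Submodule ℝ A} (hn : IsCompl (lieSub hρ) n) :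
    ∃ e : OpenPartialHomeomorph (P × n) A, (∀ x, e x = φ x.1 * (1 + (x.2 : A))) ∧
      (0 : P × n) ∈ e.source ∧ ∃ D' : A →L[ℝ] P × n, HasStrictFDerivAt e.symm D' 1 := by
  let Λ : P × n →L[ℝ] A := D.comp (ContinuousLinearMap.fst ℝ P n) +
    n.subtypeL.comp (ContinuousLinearMap.snd ℝ P n)
  have hΛ : ∀ x, Λ x = D x.1 + (x.2 : A) := fun x => rfl
  have hbij : Function.Bijective Λ := by
    constructor
    · rw [injective_iff_map_eq_zero]
      rintro ⟨p, N⟩ h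
      rw [hΛ] at h
      have hDp : D p ∈ lieSub hρ := hDr ▸ ⟨p, rfl⟩
      have h1 : D p ∈ n := by
        rw [eq_neg_of_add_eq_zero_left h]; exact n.neg_mem N.2
      have h2 : D p = 0 := Submodule.disjoint_def.1 hn.disjoint _ hDp h1
      rw [h2, zero_add] at h
      have hp : p = 0 := hD (by rw [h2, map_zero])
      ext1
      · exact hp
      · exact Subtype.ext h
    · intro a
      have : a ∈ lieSub hρ ⊔ n := hn.sup_eq_top ▸ Submodule.mem_top
      obtain ⟨y, hy, z, hz, rfl⟩ := Submodule.mem_sup.1 this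
      rw [← hDr] at hy
      obtain ⟨p, rfl⟩ := hy
      exact ⟨(p, ⟨z, hz⟩), rfl⟩
  let Λe : (P × n) ≃L[ℝ] A := (LinearEquiv.ofBijective (Λ : P × n →ₗ[ℝ] A) hbij).toContinuousLinearEquiv
  have hΘ : HasStrictFDerivAt (fun x : P × n => φ x.1 * (1 + (x.2 : A))) (Λe : P × n →L[ℝ] A) 0 := by
    have h1 : HasStrictFDerivAt (fun x : P × n => φ x.1) (D.comp (ContinuousLinearMap.fst ℝ P n)) 0 :=
      HasStrictFDerivAt.comp (0 : P × n) (g := φ) hφ hasStrictFDerivAt_fst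
    have h2 : HasStrictFDerivAt (fun x : P × n => 1 + (x.2 : A))
        (n.subtypeL.comp (ContinuousLinearMap.snd ℝ P n)) 0 :=
      ((n.subtypeL.comp (ContinuousLinearMap.snd ℝ P n)).hasStrictFDerivAt).const_add 1
    refine (h1.mul' h2).congr_fderiv ?_
    refine ContinuousLinearMap.ext fun x => ?_
    show φ 0 * (x.2 : A) + D x.1 * (1 + ((0 : n) : A)) = D x.1 + (x.2 : A)
    rw [hφ1, ZeroMemClass.coe_zero, add_zero, one_mul, mul_one, add_comm]
  refine ⟨hΘ.toOpenPartialHomeomorph _, fun x => rfl, hΘ.mem_toOpenPartialHomeomorph_source,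
    (Λe.symm : A →L[ℝ] P × n), ?_⟩
  have := hΘ.to_localInverse
  simp only [Prod.fst_zero, Prod.snd_zero, hφ1, ZeroMemClass.coe_zero, add_zero, mul_one] at this
  exact this

/-- Parametrisations of the group near `1` have continuous local inverses. -/
theorem exists_chart {φ : P → A} {D : P →L[ℝ] A}
    (hφ : HasStrictFDerivAt φ D 0) (hφ1 : φ 0 = 1)
    (hφr : ∀ p, φ p ∈ range ρ)
    (hD : Function.Injective D) (hDr : LinearMap.range (D : P →ₗ[ℝ] A) = lieSub hρ) :
    ∃ q : G → P, q 1 = 0 ∧ (∀ᶠ g in 𝓝 (1 : G), ContinuousAt q g ∧ φ (q g) = ρ g) ∧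
      ∀ᶠ p in 𝓝 (0 : P), ∀ g, ρ g = φ p → q g = p := by
  obtain ⟨n, hn⟩ := (lieSub hρ).exists_isCompl
  obtain ⟨e, he, h0, -⟩ := exists_tubular hρ hφ hφ1 hD hDr hn
  obtain ⟨ε, hε, htr⟩ := transversality hρ hn.disjoint
  have he0 : e 0 = 1 := by simp [he, hφ1]
  have hs0 : e.symm 1 = 0 := by rw [← he0, e.left_inv h0]
  have h1t : (1 : A) ∈ e.target := he0 ▸ e.map_source h0
  have hρ1 : Tendsto ρ (𝓝 1) (𝓝 1) := by simpa using hρ.tendsto 1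
  refine ⟨fun g => (e.symm (ρ g)).1, by simp [hs0], ?_, ?_⟩
  · have hT : ∀ᶠ g in 𝓝 (1 : G), ρ g ∈ e.target := hρ1 (e.open_target.mem_nhds h1t)
    have hsm : ∀ᶠ g in 𝓝 (1 : G), ‖(e.symm (ρ g)).2‖ < ε := by
      have hc : Tendsto (fun g => (e.symm (ρ g)).2) (𝓝 (1 : G)) (𝓝 0) := by
        have h2 : Tendsto e.symm (𝓝 1) (𝓝 0) := by
          simpa [hs0] using (e.symm.continuousAt h1t).tendsto
        exact (continuous_snd.tendsto' (0 : P × n) 0 rfl).comp (h2.comp hρ1)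
      have := hc.norm
      rw [norm_zero] at this
      exact this.eventually_lt_const hε
    filter_upwards [hT, hsm] with g hg hg'
    refine ⟨?_, ?_⟩
    · exact continuous_fst.continuousAt.comp
        (ContinuousAt.comp (f := ρ) (e.symm.continuousAt hg) hρ.continuousAt)
    · have h := e.right_inv hg
      rw [he] at h
      obtain ⟨k, hk⟩ := hφr (e.symm (ρ g)).1
      have hN : 1 + ((e.symm (ρ g)).2 : A) = ρ (k⁻¹ * g) := by
        have h3 := congrArg (ρ k⁻¹ * ·) h
        beta_reduce at h3
        rw [← hk, ← mul_assoc, map_inv_mul_map, one_mul] at h3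
        rw [map_mul, h3]
      have := htr _ (e.symm (ρ g)).2.2 hg' ⟨_, hN.symm⟩
      rwa [this, add_zero, mul_one] at h
  · have hcont : Tendsto (fun p : P => ((p, 0) : P × n)) (𝓝 0) (𝓝 0) :=
      (Continuous.prodMk continuous_id continuous_const).tendsto' _ _ rfl
    filter_upwards [hcont (e.open_source.mem_nhds h0)] with p hp g hg
    have : ρ g = e (p, 0) := by rw [he, hg]; simp
    show (e.symm (ρ g)).1 = p
    rw [this, e.left_inv hp]

theorem exp_lie_strict :
    HasStrictFDerivAt (fun X : lieSub hρ => exp (X : A)) ((lieSub hρ).subtypeL) 0 := by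
  have h := HasStrictFDerivAt.comp (0 : lieSub hρ) (g := (exp : A → A))
    (f := (lieSub hρ).subtypeL) (by simpa using exp_hasStrictFDerivAt_zero (A := A))
    ((lieSub hρ).subtypeL.hasStrictFDerivAt)
  exact h

/-- The exponential chart. -/
theorem exists_expChart :
    ∃ q : G → lieSub hρ, q 1 = 0 ∧
      (∀ᶠ g in 𝓝 (1 : G), ContinuousAt q g ∧ exp (q g : A) = ρ g) ∧
      ∀ᶠ p : lieSub hρ in 𝓝 0, ∀ g, ρ g = exp (p : A) → q g = p := by
  refine exists_chart hρ (exp_lie_strict hρ) (by simp [NormedSpace.exp_zero])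
    (fun p => exp_mem_of_mem_lieSet ρ p.2) Subtype.val_injective ?_
  exact (lieSub hρ).range_subtype

/-- A locally Lipschitz neighbourhood retraction onto the group. -/
theorem exists_retraction (hρ : Continuous ρ) (hinj : Function.Injective ρ) :
    ∃ (r : A → G) (δ : ℝ) (C : NNReal), 0 < δ ∧ ∀ k, r (ρ k) = k ∧
      LipschitzOnWith C (fun a => ρ (r a)) (Metric.ball (ρ k) δ) := by
  classical
  obtain ⟨n, hn⟩ := (lieSub hρ).exists_isCompl
  obtain ⟨e, he, h0, D', hD'⟩ := exists_tubular hρ (exp_lie_strict hρ)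
    (by simp [NormedSpace.exp_zero]) Subtype.val_injective ((lieSub hρ).range_subtype) hn
  obtain ⟨M, hM0, hM⟩ := exists_norm_le_rep hρ
  obtain ⟨q, hq1, hq, -⟩ := exists_expChart hρ
  have he0 : e 0 = 1 := by simp [he, NormedSpace.exp_zero]
  have hs0 : e.symm 1 = 0 := by rw [← he0, e.left_inv h0]
  have h1t : (1 : A) ∈ e.target := he0 ▸ e.map_source h0
  obtain ⟨ε₁, hε₁, hball⟩ := Metric.mem_nhds_iff.1 (e.open_source.mem_nhds h0)
  -- points of the group close to `1` are exponentials of small elements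
  have hexp : ∀ᶠ g in 𝓝 (1 : G), ∃ X : lieSub hρ, ‖X‖ < ε₁ ∧ exp (X : A) = ρ g := by
    have hqc : Tendsto q (𝓝 1) (𝓝 0) := hq1 ▸ (hq.self_of_nhds.1).tendsto
    have h2 : ∀ᶠ g in 𝓝 (1 : G), ‖q g‖ < ε₁ := by
      have := hqc.norm
      rw [norm_zero] at this
      exact this.eventually_lt_const hε₁
    filter_upwards [hq, h2] with g h h'
    exact ⟨q g, h', h.2⟩
  obtain ⟨ε₂, hε₂, hexp⟩ : ∃ ε₂ > 0, ∀ g, ‖ρ g - 1‖ < ε₂ →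
      ∃ X : lieSub hρ, ‖X‖ < ε₁ ∧ exp (X : A) = ρ g := by
    rw [(isClosedEmbedding_rep hρ hinj).nhds_eq_comap, map_one] at hexp
    obtain ⟨ε₂, hε₂, h⟩ := (Metric.nhds_basis_ball.comap ρ).eventually_iff.1 hexp
    exact ⟨ε₂, hε₂, fun g hg => h (by simpa [dist_eq_norm] using hg)⟩
  obtain ⟨ε, hε, hεε₁, hεε₂⟩ : ∃ ε > 0, ε ≤ ε₁ ∧ ε * (1 + M) ≤ ε₂ :=
    ⟨min ε₁ (ε₂ / (1 + M)), by positivity, min_le_left _ _, by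
      rw [← le_div_iff₀ (by positivity)]; exact min_le_right _ _⟩
  let R : A → G → Prop := fun a g => ∃ N : n, ‖N‖ < ε ∧ a = ρ g * (1 + (N : A))
  have huniq : ∀ a g g', R a g → R a g' → g = g' := by
    rintro a g g' ⟨N, hN, rfl⟩ ⟨N', hN', h⟩
    have h1 : ρ (g'⁻¹ * g) * (1 + (N : A)) = 1 + (N' : A) := by
      rw [map_mul, mul_assoc, h, ← mul_assoc, map_inv_mul_map, one_mul]
    have h2 : ‖ρ (g'⁻¹ * g) - 1‖ < ε₂ := by
      have : ρ (g'⁻¹ * g) - 1 = N' - ρ (g'⁻¹ * g) * N := by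
        rw [mul_add, mul_one] at h1
        rw [sub_eq_sub_iff_add_eq_add, h1, add_comm]
      rw [this]
      refine lt_of_lt_of_le ?_ hεε₂
      calc ‖(N' : A) - ρ (g'⁻¹ * g) * N‖ ≤ ‖(N' : A)‖ + ‖ρ (g'⁻¹ * g)‖ * ‖(N : A)‖ :=
            (norm_sub_le _ _).trans (add_le_add_right (norm_mul_le _ _) _)
        _ < ε + M * ε := add_lt_add_of_lt_of_le hN' (by
            gcongr
            · exact hM _
            · exact hN.le)
        _ = ε * (1 + M) := by ring
    obtain ⟨X, hX, hXe⟩ := hexp _ h2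
    have h3 : e (X, N) = e (0, N') := by
      rw [he, he, hXe, h1]; simp [NormedSpace.exp_zero]
    have h4 := e.injOn (hball (mem_ball_zero_iff.2 (max_lt hX (hN.trans_le hεε₁))))
      (hball (mem_ball_zero_iff.2 (max_lt (by simpa using hε₁) (hN'.trans_le hεε₁)))) h3
    have hX0 : X = 0 := (Prod.ext_iff.1 h4).1
    rw [hX0, ZeroMemClass.coe_zero, NormedSpace.exp_zero, ← map_one ρ] at hXe
    exact (inv_mul_eq_one.1 (hinj hXe).symm).symm
  let r : A → G := fun a => if h : ∃ g, R a g then h.choose else 1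
  have hr : ∀ a g, R a g → r a = g := fun a g h => by
    have hex : ∃ g, R a g := ⟨g, h⟩
    simp only [r, dif_pos hex]
    exact huniq a _ _ hex.choose_spec h
  -- local description of `r`
  let E : A → A := fun b => exp (((e.symm b).1 : lieSub hρ) : A)
  have hE : ∃ C : NNReal, ∃ s ∈ 𝓝 (1 : A), LipschitzOnWith C E s := by
    have h1 : HasStrictFDerivAt (fun b => (e.symm b).1) ((ContinuousLinearMap.fst ℝ _ _).comp D') 1 :=
      HasStrictFDerivAt.comp (1 : A) (g := Prod.fst) hasStrictFDerivAt_fst hD'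
    have h2 : HasStrictFDerivAt E ((lieSub hρ).subtypeL.comp
        ((ContinuousLinearMap.fst ℝ _ _).comp D')) 1 :=
      HasStrictFDerivAt.comp (1 : A) (g := fun X : lieSub hρ => exp (X : A))
        (by rw [hs0]; exact exp_lie_strict hρ) h1
    exact h2.exists_lipschitzOnWith
  obtain ⟨C, s, hs, hC⟩ := hE
  have hnear : ∀ᶠ b in 𝓝 (1 : A), b ∈ s ∧ b ∈ e.target ∧ ‖(e.symm b).2‖ < ε := by
    have h2 : Tendsto (fun b => ‖(e.symm b).2‖) (𝓝 1) (𝓝 0) := by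
      have h3 : Tendsto e.symm (𝓝 1) (𝓝 0) := by
        simpa [hs0] using (e.symm.continuousAt h1t).tendsto
      simpa using ((continuous_snd.tendsto' (0 : lieSub hρ × n) 0 rfl).comp h3).norm
    filter_upwards [hs, e.open_target.mem_nhds h1t, h2.eventually_lt_const hε] with b h h' h''
    exact ⟨h, h', h''⟩
  obtain ⟨δ₁, hδ₁, hδ⟩ := Metric.eventually_nhds_iff_ball.1 hnear
  have hshift : ∀ k : G, ∀ a ∈ Metric.ball (ρ k) (δ₁ / M), ρ k⁻¹ * a ∈ Metric.ball (1 : A) δ₁ := by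
    intro k a ha
    rw [Metric.mem_ball, dist_eq_norm] at ha ⊢
    have : ρ k⁻¹ * a - 1 = ρ k⁻¹ * (a - ρ k) := by rw [mul_sub, map_inv_mul_map]
    rw [this]
    calc ‖ρ k⁻¹ * (a - ρ k)‖ ≤ ‖ρ k⁻¹‖ * ‖a - ρ k‖ := norm_mul_le _ _
      _ ≤ M * ‖a - ρ k‖ := by gcongr; exact hM _
      _ < M * (δ₁ / M) := by gcongr
      _ = δ₁ := by field_simp
  have hrE : ∀ k : G, ∀ a ∈ Metric.ball (ρ k) (δ₁ / M), ρ (r a) = ρ k * E (ρ k⁻¹ * a) := by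
    intro k a ha
    obtain ⟨-, hb2, hb3⟩ := hδ _ (hshift k a ha)
    obtain ⟨x, hx⟩ := exp_mem_of_mem_lieSet ρ (e.symm (ρ k⁻¹ * a)).1.2
    have h := e.right_inv hb2
    rw [he] at h
    have : r a = k * x := by
      refine hr _ _ ⟨(e.symm (ρ k⁻¹ * a)).2, hb3, ?_⟩
      rw [map_mul, hx, mul_assoc, h, ← mul_assoc, map_mul_map_inv, one_mul]
    rw [this, map_mul, hx]
  refine ⟨r, δ₁ / M, M.toNNReal * C * M.toNNReal, by positivity, fun k => ⟨?_, ?_⟩⟩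
  · exact hr _ _ ⟨0, by simpa using hε, by simp⟩
  · refine LipschitzOnWith.of_dist_le_mul fun a ha b hb => ?_
    rw [hrE k a ha, hrE k b hb, dist_eq_norm, ← mul_sub]
    have h1 := hC.dist_le_mul _ (hδ _ (hshift k a ha)).1 _ (hδ _ (hshift k b hb)).1
    rw [dist_eq_norm, dist_eq_norm, ← mul_sub] at h1
    calc ‖ρ k * (E (ρ k⁻¹ * a) - E (ρ k⁻¹ * b))‖
        ≤ ‖ρ k‖ * ‖E (ρ k⁻¹ * a) - E (ρ k⁻¹ * b)‖ := norm_mul_le _ _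
      _ ≤ M * (C * (M * ‖a - b‖)) := by
          gcongr
          · exact hM _
          · refine h1.trans ?_
            gcongr
            exact (norm_mul_le _ _).trans (by gcongr; exact hM _)
      _ = _ := by rw [dist_eq_norm]; push_cast; rw [Real.coe_toNNReal _ hM0.le]; ring

end Charts

section Extension

universe v w

variable {A : Type*} [NormedRing A] [NormedAlgebra ℝ A] [CompleteSpace A] [FiniteDimensional ℝ A]
  {G : Type*} [Group G] [TopologicalSpace G] [CompactSpace G]
  {ρ : G →* A}

/-- A continuous map into `A` with values in the image of the group lifts to the group. -/
theorem exists_lift_of_mem_range (hρ : Continuous ρ) (hinj : Function.Injective ρ)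
    {Z : Type*} [TopologicalSpace Z] (F : C(Z, A)) (hF : ∀ z, F z ∈ range ρ) :
    ∃ F' : C(Z, G), ∀ z, ρ (F' z) = F z := by
  choose F' hF' using hF
  refine ⟨⟨F', (isClosedEmbedding_rep hρ hinj).isInducing.continuous_iff.2 ?_⟩, hF'⟩
  have : ρ ∘ F' = F := funext hF'
  rw [this]
  exact F.continuous

/-- The exponential map into the group. -/
theorem exists_expMap (hρ : Continuous ρ) (hinj : Function.Injective ρ) :
    ∃ E : C(lieSub hρ, G), ∀ X, ρ (E X) = exp (X : A) :=
  exists_lift_of_mem_range hρ hinj ⟨fun X : lieSub hρ => exp (X : A),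
    continuous_exp.comp continuous_subtype_val⟩ fun X => exp_mem_of_mem_lieSet ρ X.2

/-- Maps close to `1` factor through the exponential map. -/
theorem exists_log_of_small (hρ : Continuous ρ) :
    ∃ U : Set G, IsOpen U ∧ (1 : G) ∈ U ∧ ∀ (B : Type w) [TopologicalSpace B] (f : C(B, G)),
      (∀ b, f b ∈ U) → ∃ X : C(B, lieSub hρ), ∀ b, exp (X b : A) = ρ (f b) := by
  obtain ⟨q, -, hq, -⟩ := exists_expChart hρ
  obtain ⟨U, hU, hUo, h1⟩ := eventually_nhds_iff.1 hq
  refine ⟨U, hUo, h1, fun B _ f hf => ⟨⟨fun b => q (f b), ?_⟩, fun b => (hU _ (hf b)).2⟩⟩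
  exact continuous_iff_continuousAt.2 fun b =>
    ContinuousAt.comp (f := f) (hU _ (hf b)).1 f.continuous.continuousAt

/-- Maps close to `1` extend from closed subsets. -/
theorem exists_extension_of_small (hρ : Continuous ρ) (hinj : Function.Injective ρ) :
    ∃ U : Set G, IsOpen U ∧ (1 : G) ∈ U ∧ ∀ (Z : Type w) [TopologicalSpace Z] [NormalSpace Z]
      (B : Set Z), IsClosed B → ∀ f : C(B, G), (∀ b, f b ∈ U) →
        ∃ F : C(Z, G), ∀ b : B, F b = f b := by
  obtain ⟨U, hUo, h1, hU⟩ := exists_log_of_small.{w} hρ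
  obtain ⟨E, hE⟩ := exists_expMap hρ hinj
  refine ⟨U, hUo, h1, fun Z _ _ B hB f hf => ?_⟩
  obtain ⟨X, hX⟩ := hU B f hf
  obtain ⟨Y, hY⟩ := X.exists_restrict_eq hB
  refine ⟨E.comp Y, fun b => hinj ?_⟩
  have : Y b = X b := DFunLike.congr_fun hY b
  rw [ContinuousMap.comp_apply, hE, this, hX]

variable [IsTopologicalGroup G]

theorem nullhomotopic_mul {B : Type*} [TopologicalSpace B] {f f' : C(B, G)}
    (h : f.Nullhomotopic) (h' : f'.Nullhomotopic) : (f * f').Nullhomotopic := by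
  obtain ⟨y, ⟨H⟩⟩ := h
  obtain ⟨y', ⟨H'⟩⟩ := h'
  exact ⟨y * y', ⟨⟨H.toContinuousMap * H'.toContinuousMap, fun x => by simp,
    fun x => by simp⟩⟩⟩

theorem nullhomotopic_of_exp (hρ : Continuous ρ) (hinj : Function.Injective ρ)
    {B : Type*} [TopologicalSpace B] (f : C(B, G)) (X : C(B, lieSub hρ))
    (h : ∀ b, exp (X b : A) = ρ (f b)) : f.Nullhomotopic := by
  obtain ⟨E, hE⟩ := exists_expMap hρ hinj
  have hf : f = E.comp X := by
    ext b
    exact hinj (by rw [← h, ContinuousMap.comp_apply, hE])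
  rw [hf]
  have : (ContinuousMap.id (lieSub hρ)).Nullhomotopic := id_nullhomotopic _
  simpa using (this.comp_right E).comp_left X

theorem exists_nullhomotopic_of_small (hρ : Continuous ρ) (hinj : Function.Injective ρ) :
    ∃ U : Set G, IsOpen U ∧ (1 : G) ∈ U ∧ ∀ (B : Type w) [TopologicalSpace B] (f : C(B, G)),
      (∀ b, f b ∈ U) → f.Nullhomotopic := by
  obtain ⟨U, hUo, h1, hU⟩ := exists_log_of_small.{w} hρ
  refine ⟨U, hUo, h1, fun B _ f hf => ?_⟩
  obtain ⟨X, hX⟩ := hU B f hf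
  exact nullhomotopic_of_exp hρ hinj f X hX

/-- Homotopy extension: a nullhomotopic map from a closed subset extends. -/
theorem exists_extension_of_nullhomotopic (hρ : Continuous ρ) (hinj : Function.Injective ρ)
    {Z : Type w} [TopologicalSpace Z] [CompactSpace Z] [T2Space Z] {B : Set Z} (hB : IsClosed B)
    (f : C(B, G)) (hf : f.Nullhomotopic) : ∃ F : C(Z, G), ∀ b : B, F b = f b := by
  obtain ⟨U, hUo, h1, hU⟩ := exists_extension_of_small.{w} hρ hinj
  let K : Subgroup C(B, G) :=
    { carrier := {f | ∃ F : C(Z, G), ∀ b : B, F b = f b}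
      mul_mem' := by
        rintro f f' ⟨F, hF⟩ ⟨F', hF'⟩
        exact ⟨F * F', fun b => by simp [hF, hF']⟩
      one_mem' := ⟨1, fun b => rfl⟩
      inv_mem' := by
        rintro f ⟨F, hF⟩
        exact ⟨F⁻¹, fun b => by simp [hF]⟩ }
  have hcB : CompactSpace B := isCompact_iff_compactSpace.1 hB.isCompact
  have hKo : IsOpen (K : Set C(B, G)) := by
    refine K.isOpen_of_mem_nhds (g := 1) (mem_of_superset
      ((ContinuousMap.isOpen_setOfPred_mapsTo isCompact_univ hUo).mem_nhds ?_)
      fun f hf => hU Z B hB f fun b => hf (mem_univ b))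
    intro b _
    exact h1
  have hKc : IsClosed (K : Set C(B, G)) := K.isClosed_of_isOpen hKo
  obtain ⟨y, ⟨H⟩⟩ := hf
  have hcl : IsClopen (H.curry ⁻¹' (K : Set C(B, G))) :=
    ⟨hKc.preimage H.curry.continuous, hKo.preimage H.curry.continuous⟩
  have hne : (H.curry ⁻¹' (K : Set C(B, G))).Nonempty := by
    refine ⟨1, ?_⟩
    rw [mem_preimage, H.curry_one]
    exact ⟨ContinuousMap.const Z y, fun b => rfl⟩
  have h0 : (0 : unitInterval) ∈ H.curry ⁻¹' (K : Set C(B, G)) := by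
    rw [hcl.eq_univ hne]; trivial
  rw [mem_preimage, H.curry_zero] at h0
  exact h0

end Extension

section Slice

variable {A : Type*} [NormedRing A] [NormedAlgebra ℝ A] [CompleteSpace A] [FiniteDimensional ℝ A]
  {G : Type*} [Group G] [TopologicalSpace G] [CompactSpace G]
  {ρ : G →* A} (hρ : Continuous ρ)

/-- The adjoint action on the Lie algebra. -/
def adL (g : G) : lieSub hρ →ₗ[ℝ] lieSub hρ where
  toFun X := ⟨ρ g * X * ρ g⁻¹, conj_mem_lieSet ρ X.2 g⟩
  map_add' X Y := Subtype.ext (by simp [mul_add, add_mul])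
  map_smul' c X := Subtype.ext (by simp)

@[simp] theorem coe_adL (g : G) (X : lieSub hρ) : (adL hρ g X : A) = ρ g * X * ρ g⁻¹ := rfl

theorem adL_mul (g h : G) (X : lieSub hρ) : adL hρ (g * h) X = adL hρ g (adL hρ h X) :=
  Subtype.ext (by simp [mul_assoc])

theorem adL_one (X : lieSub hρ) : adL hρ 1 X = X := Subtype.ext (by simp)

/-- The centralizer of a group element in the Lie algebra. -/
noncomputable def cent (g : G) : Submodule ℝ (lieSub hρ) := LinearMap.ker (adL hρ g - LinearMap.id)

/-- The image of `Ad g - 1`. -/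
noncomputable def mv (g : G) : Submodule ℝ (lieSub hρ) := LinearMap.range (adL hρ g - LinearMap.id)

theorem mem_cent_iff_adL {g : G} {X : lieSub hρ} : X ∈ cent hρ g ↔ adL hρ g X = X := by
  rw [cent, LinearMap.mem_ker, LinearMap.sub_apply, LinearMap.id_apply, sub_eq_zero]

theorem mem_cent {g : G} {X : lieSub hρ} : X ∈ cent hρ g ↔ ρ g * X = X * ρ g := by
  rw [mem_cent_iff_adL, Subtype.ext_iff, coe_adL]
  constructor
  · intro h
    calc ρ g * (X : A) = ρ g * X * (ρ g⁻¹ * ρ g) := by rw [map_inv_mul_map, mul_one]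
      _ = X * ρ g := by rw [← mul_assoc, h]
  · intro h
    rw [h, mul_assoc, map_mul_map_inv, mul_one]

theorem mem_mv {g : G} {X : lieSub hρ} : X ∈ mv hρ g ↔ ∃ Y, adL hρ g Y - Y = X := Iff.rfl

theorem exists_norm_adL_le : ∃ M : ℝ, 0 < M ∧ ∀ (g : G) (X : lieSub hρ), ‖adL hρ g X‖ ≤ M * ‖X‖ := by
  obtain ⟨M, hM0, hM⟩ := exists_norm_le_rep hρ
  refine ⟨M * M, by positivity, fun g X => ?_⟩
  calc ‖ρ g * X * ρ g⁻¹‖ ≤ ‖ρ g‖ * ‖(X : A)‖ * ‖ρ g⁻¹‖ :=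
        (norm_mul_le _ _).trans (by gcongr; exact norm_mul_le _ _)
    _ ≤ M * ‖(X : A)‖ * M := by gcongr <;> exact hM _
    _ = M * M * ‖X‖ := by rw [Submodule.coe_norm]; ring

theorem disjoint_cent_mv (g : G) : Disjoint (cent hρ g) (mv hρ g) := by
  obtain ⟨M, -, hM⟩ := exists_norm_adL_le hρ
  rw [Submodule.disjoint_def]
  rintro Y hY ⟨X, hX⟩
  rw [mem_cent_iff_adL] at hY
  have hX' : adL hρ g X = X + Y := by
    rw [LinearMap.sub_apply, LinearMap.id_apply] at hX
    rw [← hX]; abel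
  have hpow : ∀ n : ℕ, adL hρ (g ^ n) X = X + (n : ℝ) • Y := by
    intro n
    induction n with
    | zero => simp [adL_one]
    | succ n ih =>
      rw [pow_succ', adL_mul, ih, map_add, map_smul, hX', hY]
      push_cast
      rw [add_smul, one_smul]; abel
  by_contra hne
  have hpos : 0 < ‖Y‖ := norm_pos_iff.2 hne
  obtain ⟨n, hn⟩ := exists_nat_gt ((M * ‖X‖ + ‖X‖) / ‖Y‖)
  rw [div_lt_iff₀ hpos] at hn
  have h1 : (n : ℝ) * ‖Y‖ ≤ M * ‖X‖ + ‖X‖ := by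
    calc (n : ℝ) * ‖Y‖ = ‖(X + (n : ℝ) • Y) - X‖ := by
          rw [add_sub_cancel_left, norm_smul, Real.norm_natCast]
      _ ≤ ‖adL hρ (g ^ n) X‖ + ‖X‖ := by rw [← hpow]; exact norm_sub_le _ _
      _ ≤ _ := by gcongr; exact hM _ _
  linarith

theorem finrank_mv_add_finrank_cent (g : G) :
    Module.finrank ℝ (mv hρ g) + Module.finrank ℝ (cent hρ g) = Module.finrank ℝ (lieSub hρ) :=
  LinearMap.finrank_range_add_finrank_ker _

theorem isCompl_cent_mv (g : G) : IsCompl (cent hρ g) (mv hρ g) :=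
  (Submodule.isCompl_iff_disjoint _ _ (by rw [add_comm, finrank_mv_add_finrank_cent])).2
    (disjoint_cent_mv hρ g)

theorem adL_mem_mv {g h : G} (hc : ρ g * ρ h = ρ h * ρ g) {X : lieSub hρ}
    (hX : X ∈ mv hρ g) : adL hρ h X ∈ mv hρ g := by
  obtain ⟨Y, hY⟩ := (mem_mv hρ).1 hX
  refine (mem_mv hρ).2 ⟨adL hρ h Y, ?_⟩
  have : adL hρ g (adL hρ h Y) = adL hρ h (adL hρ g Y) := by
    have h2 : ρ h⁻¹ * ρ g⁻¹ = ρ g⁻¹ * ρ h⁻¹ := by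
      have h3 : ρ (h⁻¹ * g⁻¹) * ρ (g * h) = 1 := by rw [← map_mul]; simp
      have h4 : ρ (g * h) * ρ (g⁻¹ * h⁻¹) = 1 := by
        rw [map_mul, hc, ← map_mul, ← map_mul]; simp
      have := left_inv_eq_right_inv h3 h4
      simpa using this
    apply Subtype.ext
    simp only [coe_adL]
    calc ρ g * (ρ h * (Y : A) * ρ h⁻¹) * ρ g⁻¹ = (ρ g * ρ h) * Y * (ρ h⁻¹ * ρ g⁻¹) := by
          simp only [mul_assoc]
      _ = (ρ h * ρ g) * Y * (ρ g⁻¹ * ρ h⁻¹) := by rw [hc, h2]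
      _ = _ := by simp only [mul_assoc]
  rw [this, ← map_sub, hY]

/-- Elements near `g₀` fix no nonzero vector of `mv g₀`. -/
theorem eventually_cent_disjoint_mv (hρ : Continuous ρ) [IsTopologicalGroup G] (g₀ : G) :
    ∀ᶠ h in 𝓝 g₀, Disjoint (cent hρ h) (mv hρ g₀) := by
  obtain ⟨M, hM0, hM⟩ := exists_norm_le_rep hρ
  have hinj : LinearMap.ker ((adL hρ g₀ - LinearMap.id).domRestrict (mv hρ g₀)) = ⊥ := by
    rw [LinearMap.ker_eq_bot']
    intro X hX
    have h1 : (X : lieSub hρ) ∈ cent hρ g₀ := hX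
    exact Subtype.ext (Submodule.disjoint_def.1 (disjoint_cent_mv hρ g₀) _ h1 X.2)
  obtain ⟨K, hK0, hK⟩ := LinearMap.exists_antilipschitzWith (𝕜 := ℝ) (E := mv hρ g₀)
    (F := lieSub hρ)
    ((adL hρ g₀ - LinearMap.id).domRestrict (mv hρ g₀)) hinj
  have hK' : ∀ X ∈ mv hρ g₀, ‖X‖ ≤ K * ‖adL hρ g₀ X - X‖ := fun X hX => by
    have := ZeroHomClass.bound_of_antilipschitz _ hK (⟨X, hX⟩ : mv hρ g₀)
    exact this
  have hK0' : (0 : ℝ) < K := hK0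
  have hcont : Continuous fun h : G => K * (‖ρ h - ρ g₀‖ * M + M * ‖ρ h⁻¹ - ρ g₀⁻¹‖) := by
    have : Continuous fun h : G => ρ h⁻¹ := hρ.comp continuous_inv
    fun_prop
  have hev : ∀ᶠ h in 𝓝 g₀, K * (‖ρ h - ρ g₀‖ * M + M * ‖ρ h⁻¹ - ρ g₀⁻¹‖) < 1 := by
    have := hcont.tendsto g₀
    simp only [sub_self, norm_zero, zero_mul, mul_zero, add_zero] at this
    exact this.eventually_lt_const one_pos
  filter_upwards [hev] with h hh
  rw [Submodule.disjoint_def]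
  intro X hXc hXm
  rw [mem_cent_iff_adL] at hXc
  by_contra hne
  have hpos : 0 < ‖X‖ := norm_pos_iff.2 hne
  have h1 : ‖adL hρ g₀ X - X‖ ≤ (‖ρ h - ρ g₀‖ * M + M * ‖ρ h⁻¹ - ρ g₀⁻¹‖) * ‖X‖ := by
    have h2 : adL hρ g₀ X - X = adL hρ g₀ X - adL hρ h X := by rw [hXc]
    rw [h2, Submodule.coe_norm, Submodule.coe_sub, coe_adL, coe_adL]
    have h3 : ρ g₀ * (X : A) * ρ g₀⁻¹ - ρ h * X * ρ h⁻¹ =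
        -((ρ h - ρ g₀) * X * ρ g₀⁻¹) - ρ h * X * (ρ h⁻¹ - ρ g₀⁻¹) := by noncomm_ring
    rw [h3]
    calc _ ≤ ‖(ρ h - ρ g₀) * X * ρ g₀⁻¹‖ + ‖ρ h * X * (ρ h⁻¹ - ρ g₀⁻¹)‖ := by
          refine (norm_sub_le _ _).trans ?_
          rw [norm_neg]
      _ ≤ ‖ρ h - ρ g₀‖ * ‖(X : A)‖ * ‖ρ g₀⁻¹‖ + ‖ρ h‖ * ‖(X : A)‖ * ‖ρ h⁻¹ - ρ g₀⁻¹‖ := by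
          gcongr
          · exact (norm_mul_le _ _).trans (by gcongr; exact norm_mul_le _ _)
          · exact (norm_mul_le _ _).trans (by gcongr; exact norm_mul_le _ _)
      _ ≤ ‖ρ h - ρ g₀‖ * ‖(X : A)‖ * M + M * ‖(X : A)‖ * ‖ρ h⁻¹ - ρ g₀⁻¹‖ := by
          gcongr <;> exact hM _
      _ = _ := by rw [Submodule.coe_norm X]; ring
  have h4 := (hK' X hXm).trans (mul_le_mul_of_nonneg_left h1 hK0'.le)
  rw [← mul_assoc] at h4
  nlinarith

/-- Elements near `g₀` commuting with `g₀` have smaller centralizers. -/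
theorem cent_le_cent_of_disjoint {g₀ h : G} (hc : ρ g₀ * ρ h = ρ h * ρ g₀)
    (hd : Disjoint (cent hρ h) (mv hρ g₀)) (hz : ∀ X ∈ cent hρ g₀, adL hρ h X ∈ cent hρ g₀) :
    cent hρ h ≤ cent hρ g₀ := by
  intro X hX
  have hX' : X ∈ cent hρ g₀ ⊔ mv hρ g₀ := (isCompl_cent_mv hρ g₀).sup_eq_top ▸ Submodule.mem_top
  obtain ⟨Z, hZ, W, hW, rfl⟩ := Submodule.mem_sup.1 hX'
  rw [mem_cent_iff_adL, map_add] at hX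
  have h1 : adL hρ h W - W = Z - adL hρ h Z := by
    rw [sub_eq_sub_iff_add_eq_add, add_comm, hX, add_comm]
  have h2 : adL hρ h W - W = 0 := by
    refine Submodule.disjoint_def.1 (disjoint_cent_mv hρ g₀) _ ?_ ?_
    · rw [h1]; exact Submodule.sub_mem _ hZ (hz _ hZ)
    · exact Submodule.sub_mem _ (adL_mem_mv hρ hc hW) hW
  have h3 : W = 0 := Submodule.disjoint_def.1 hd _
    ((mem_cent_iff_adL hρ).2 (sub_eq_zero.1 h2)) hW
  rw [h3, add_zero]
  exact hZ

end Slice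

section SliceChart

variable {A : Type*} [NormedRing A] [NormedAlgebra ℝ A] [CompleteSpace A] [FiniteDimensional ℝ A]
  {G : Type*} [Group G] [TopologicalSpace G] [CompactSpace G]
  {ρ : G →* A} (hρ : Continuous ρ)

theorem hasStrictFDerivAt_exp_comp {P : Type*} [NormedAddCommGroup P] [NormedSpace ℝ P]
    (L : P →L[ℝ] A) : HasStrictFDerivAt (fun p => exp (L p)) L 0 := by
  have h : HasStrictFDerivAt (exp : A → A) ((ContinuousLinearEquiv.refl ℝ A : A →L[ℝ] A)) (L 0) := by
    rw [map_zero]; exact exp_hasStrictFDerivAt_zero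
  exact (h.comp (0 : P) L.hasStrictFDerivAt).congr_fderiv (by ext; simp)

theorem hasStrictFDerivAt_exp_mul_exp_mul_exp {P : Type*} [NormedAddCommGroup P] [NormedSpace ℝ P]
    (L₁ L₂ L₃ : P →L[ℝ] A) :
    HasStrictFDerivAt (fun p => exp (L₁ p) * exp (L₂ p) * exp (L₃ p)) (L₁ + L₂ + L₃) 0 := by
  have e1 := hasStrictFDerivAt_exp_comp L₁
  have e2 := hasStrictFDerivAt_exp_comp L₂
  have e3 := hasStrictFDerivAt_exp_comp L₃
  refine ((e1.mul' e2).mul' e3).congr_fderiv ?_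
  ext p
  simp [NormedSpace.exp_zero]
  abel

theorem exists_slice [IsTopologicalGroup G] (g₀ : G) :
    ∃ Y τ : G → lieSub hρ, Y g₀ = 0 ∧ τ g₀ = 0 ∧
      (∀ g, Y g ∈ mv hρ g₀ ∧ τ g ∈ cent hρ g₀) ∧
      ∀ᶠ g in 𝓝 g₀, ContinuousAt Y g ∧ ContinuousAt τ g ∧
        ρ g = exp (Y g : A) * ρ g₀ * exp (τ g : A) * exp (-(Y g : A)) := by
  let l1 : (mv hρ g₀ × cent hρ g₀) →ₗ[ℝ] lieSub hρ := adL hρ g₀⁻¹ ∘ₗ (mv hρ g₀).subtype ∘ₗ LinearMap.fst ℝ _ _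
  let l2 : (mv hρ g₀ × cent hρ g₀) →ₗ[ℝ] lieSub hρ := (cent hρ g₀).subtype ∘ₗ LinearMap.snd ℝ _ _
  let l3 : (mv hρ g₀ × cent hρ g₀) →ₗ[ℝ] lieSub hρ := (mv hρ g₀).subtype ∘ₗ LinearMap.fst ℝ _ _
  let up : ((mv hρ g₀ × cent hρ g₀) →ₗ[ℝ] lieSub hρ) → ((mv hρ g₀ × cent hρ g₀) →L[ℝ] A) := fun l =>
    LinearMap.toContinuousLinearMap ((lieSub hρ).subtype ∘ₗ l)
  let φ : mv hρ g₀ × cent hρ g₀ → A := fun p => exp (up l1 p) * exp (up l2 p) * exp (up (-l3) p)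
  have hφ : HasStrictFDerivAt φ (up (l1 + l2 - l3)) 0 := by
    refine (hasStrictFDerivAt_exp_mul_exp_mul_exp (A := A) (P := mv hρ g₀ × cent hρ g₀) (up l1) (up l2) (up (-l3))).congr_fderiv ?_
    ext p
    all_goals
      simp only [up, ContinuousLinearMap.coe_comp, Function.comp_apply, add_apply,
        LinearMap.coe_toContinuousLinearMap', LinearMap.comp_apply, LinearMap.add_apply,
        LinearMap.sub_apply, LinearMap.neg_apply, map_add, map_sub, map_neg]
      abel
  have hcomm : ρ g₀ * ρ g₀⁻¹ = ρ g₀⁻¹ * ρ g₀ := by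
    rw [map_mul_map_inv, map_inv_mul_map]
  have hinj : Function.Injective (up (l1 + l2 - l3)) := by
    rw [injective_iff_map_eq_zero]
    intro p hp
    have hp' : adL hρ g₀⁻¹ p.1 + p.2 - p.1 = 0 := Subtype.ext hp
    have h1 : adL hρ g₀⁻¹ p.1 - p.1 ∈ mv hρ g₀ :=
      Submodule.sub_mem _ (adL_mem_mv hρ hcomm p.1.2) p.1.2
    have h2 : (p.2 : lieSub hρ) = -(adL hρ g₀⁻¹ p.1 - p.1) := by
      rw [eq_neg_iff_add_eq_zero, ← hp']; abel
    have h3 : (p.2 : lieSub hρ) = 0 := Submodule.disjoint_def.1 (disjoint_cent_mv hρ g₀) _ p.2.2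
      (h2 ▸ Submodule.neg_mem _ h1)
    rw [h3, add_zero, sub_eq_zero] at hp'
    have h4 : adL hρ g₀ p.1 = (p.1 : lieSub hρ) := by
      conv_lhs => rw [← hp']
      rw [← adL_mul, mul_inv_cancel, adL_one]
    have h5 : (p.1 : lieSub hρ) = 0 := Submodule.disjoint_def.1 (disjoint_cent_mv hρ g₀) _
      ((mem_cent_iff_adL hρ).2 h4) p.1.2
    exact Prod.ext (Subtype.ext h5) (Subtype.ext h3)
  obtain ⟨q, hq1, hq2, -⟩ := exists_chart hρ (φ := φ) hφ (by simp [φ, NormedSpace.exp_zero])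
    (fun p => by
      have : ∀ l : (mv hρ g₀ × cent hρ g₀) →ₗ[ℝ] lieSub hρ, exp (up l p) ∈ range ρ := fun l =>
        exp_mem_of_mem_lieSet ρ (l p).2
      obtain ⟨a, ha⟩ := this l1
      obtain ⟨b, hb⟩ := this l2
      obtain ⟨c, hc⟩ := this (-l3)
      exact ⟨a * b * c, by simp only [φ, map_mul, ha, hb, hc]⟩)
    hinj (by
      have hle : LinearMap.range (up (l1 + l2 - l3) : (mv hρ g₀ × cent hρ g₀) →ₗ[ℝ] A) ≤ lieSub hρ := by
        rintro _ ⟨p, rfl⟩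
        exact ((l1 + l2 - l3) p).2
      refine Submodule.eq_of_le_of_finrank_eq hle ?_
      rw [LinearMap.finrank_range_of_inj hinj, Module.finrank_prod, finrank_mv_add_finrank_cent])
  have hsh : Tendsto (fun g => g₀⁻¹ * g) (𝓝 g₀) (𝓝 1) := by
    have : Continuous (fun g => g₀⁻¹ * g) := by fun_prop
    simpa using this.tendsto g₀
  refine ⟨fun g => (q (g₀⁻¹ * g)).1, fun g => (q (g₀⁻¹ * g)).2, by simp [hq1], by simp [hq1],
    fun g => ⟨(q (g₀⁻¹ * g)).1.2, (q (g₀⁻¹ * g)).2.2⟩, ?_⟩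
  filter_upwards [hsh.eventually hq2] with g hg
  obtain ⟨hc, he⟩ := hg
  have hc' : ContinuousAt (fun g => q (g₀⁻¹ * g)) g :=
    ContinuousAt.comp (f := fun g => g₀⁻¹ * g) hc (by fun_prop)
  refine ⟨by fun_prop, by fun_prop, ?_⟩
  have h1 : ρ g = ρ g₀ * ρ (g₀⁻¹ * g) := by rw [← map_mul, mul_inv_cancel_left]
  rw [h1, ← he]
  set p := q (g₀⁻¹ * g)
  have h2 : up l1 p = ρ g₀⁻¹ * (p.1 : A) * ρ g₀ := by simp [up, l1]
  have h3 : up l2 p = (p.2 : A) := rfl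
  have h4 : up (-l3) p = -(p.1 : A) := rfl
  simp only [φ]
  rw [h2, h3, h4, exp_conj (map_inv_mul_map ρ g₀) (map_mul_map_inv ρ g₀)]
  simp only [← mul_assoc]
  rw [map_mul_map_inv, one_mul]

end SliceChart

section CenterCodim

variable {A : Type*} [NormedRing A] [NormedAlgebra ℝ A] [CompleteSpace A]

theorem hasDerivAt_conj (x w : A) (t : ℝ) :
    HasDerivAt (fun s : ℝ => exp (s • x) * w * exp (s • (-x)))
      (exp (t • x) * (x * w - w * x) * exp (t • (-x))) t := by
  have h1 : HasDerivAt (fun s : ℝ => exp (s • x)) (exp (t • x) * x) t :=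
    hasDerivAt_exp_smul_const x t
  have h2 : HasDerivAt (fun s : ℝ => exp (s • (-x))) (-x * exp (t • (-x))) t :=
    hasDerivAt_exp_smul_const' (-x) t
  refine ((h1.mul_const w).fun_mul h2).congr_deriv ?_
  noncomm_ring

theorem eq_zero_of_bounded_ad {x w : A} {M b : ℝ} (hM : ∀ t : ℝ, ‖exp (t • x)‖ ≤ M)
    (hw : w ≠ 0) (h : x * w - w * x = b • w) : b = 0 := by
  have hd : ∀ t : ℝ, HasDerivAt
      (fun s : ℝ => Real.exp (-(b * s)) • (exp (s • x) * w * exp (s • (-x)))) 0 t := by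
    intro t
    have h1 : HasDerivAt (fun s : ℝ => Real.exp (-(b * s))) (Real.exp (-(b * t)) * -b) t := by
      have := ((hasDerivAt_id t).const_mul b).fun_neg
      simp only [id, mul_one] at this
      exact this.exp
    refine (h1.fun_smul (hasDerivAt_conj x w t)).congr_deriv ?_
    rw [h]
    simp only [mul_smul_comm, smul_mul_assoc, smul_smul]
    rw [← add_smul]
    ring_nf
    simp
  have hc := is_const_of_deriv_eq_zero (fun t => (hd t).differentiableAt) (fun t => (hd t).deriv)
  have hM0 : 0 ≤ M := (norm_nonneg _).trans (hM 0)
  have key : ∀ t : ℝ, ‖w‖ ≤ Real.exp (-(b * t)) * (M * ‖w‖ * M) := by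
    intro t
    have h0 := hc 0 t
    simp only [mul_zero, neg_zero, Real.exp_zero, zero_smul, NormedSpace.exp_zero, one_mul,
      mul_one, one_smul] at h0
    have hn : ‖exp (t • (-x))‖ ≤ M := by
      have := hM (-t); rwa [neg_smul, ← smul_neg] at this
    calc ‖w‖ = ‖Real.exp (-(b * t)) • (exp (t • x) * w * exp (t • (-x)))‖ := by rw [← h0]
      _ = Real.exp (-(b * t)) * ‖exp (t • x) * w * exp (t • (-x))‖ := by
          rw [norm_smul, Real.norm_eq_abs, abs_of_pos (Real.exp_pos _)]
      _ ≤ _ := by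
          gcongr
          refine (norm_mul_le _ _).trans ?_
          gcongr
          · exact (norm_mul_le _ _).trans (by gcongr; exact hM t)
  by_contra hb
  have hw' : 0 < ‖w‖ := norm_pos_iff.2 hw
  have hMM : M * ‖w‖ * M < Real.exp (M * M) * ‖w‖ := by
    have := Real.add_one_le_exp (M * M)
    nlinarith
  have h2 := key (M * M / b)
  rw [mul_div_cancel₀ _ hb, Real.exp_neg] at h2
  have h3 : Real.exp (M * M) * ‖w‖ ≤ M * ‖w‖ * M := by
    have := mul_le_mul_of_nonneg_left h2 (Real.exp_pos (M * M)).le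
    rwa [← mul_assoc, mul_inv_cancel₀ (Real.exp_pos _).ne', one_mul] at this
  linarith

theorem commute_of_bounded_ad {x y w : A} {M : ℝ} (hM : ∀ t : ℝ, ‖exp (t • x)‖ ≤ M)
    (h : x * y - y * x = w) (hw : x * w = w * x) : w = 0 := by
  have hconj : ∀ t : ℝ, exp (t • x) * w * exp (t • (-x)) = w := fun t => by
    have hc : Commute (exp (t • x)) w := by
      have : Commute x w := hw
      exact (this.smul_left t).exp_left
    rw [hc.eq, mul_assoc, smul_neg, exp_mul_exp_neg, mul_one]
  have hd : ∀ t : ℝ, HasDerivAt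
      (fun s : ℝ => exp (s • x) * y * exp (s • (-x)) - s • w) 0 t := by
    intro t
    have h1 : HasDerivAt (fun s : ℝ => s • w) ((1 : ℝ) • w) t := (hasDerivAt_id t).smul_const w
    refine ((hasDerivAt_conj x y t).fun_sub h1).congr_deriv ?_
    rw [h, hconj, one_smul, sub_self]
  have hc := is_const_of_deriv_eq_zero (fun t => (hd t).differentiableAt) (fun t => (hd t).deriv)
  have hM0 : 0 ≤ M := (norm_nonneg _).trans (hM 0)
  by_contra hne
  have hw' : 0 < ‖w‖ := norm_pos_iff.2 hne
  obtain ⟨n, hn⟩ := exists_nat_gt ((M * ‖y‖ * M + ‖y‖) / ‖w‖)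
  rw [div_lt_iff₀ hw'] at hn
  have h0 := hc 0 n
  simp only [zero_smul, NormedSpace.exp_zero, one_mul, mul_one, sub_zero] at h0
  have hnb : ‖exp ((n : ℝ) • (-x))‖ ≤ M := by
    have := hM (-n); rwa [neg_smul, ← smul_neg] at this
  have h1 : (n : ℝ) * ‖w‖ ≤ M * ‖y‖ * M + ‖y‖ := by
    calc (n : ℝ) * ‖w‖ = ‖(n : ℝ) • w‖ := by rw [norm_smul, Real.norm_natCast]
      _ = ‖exp ((n : ℝ) • x) * y * exp ((n : ℝ) • (-x)) - y‖ := by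
          congr 1
          rw [eq_sub_iff_add_eq, add_comm]
          exact eq_sub_iff_add_eq.1 h0
      _ ≤ ‖exp ((n : ℝ) • x) * y * exp ((n : ℝ) • (-x))‖ + ‖y‖ := norm_sub_le _ _
      _ ≤ _ := by
          gcongr
          refine (norm_mul_le _ _).trans ?_
          gcongr
          · exact (norm_mul_le _ _).trans (by gcongr; exact hM n)
  linarith

/-- The centre of a space of elements, with respect to the commutator. -/
def commCenter (T : Submodule ℝ A) : Submodule ℝ A where
  carrier := {c | c ∈ T ∧ ∀ x ∈ T, c * x = x * c}
  zero_mem' := ⟨T.zero_mem, by simp⟩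
  add_mem' := fun ha hb => ⟨T.add_mem ha.1 hb.1, fun x hx => by
    rw [add_mul, mul_add, ha.2 x hx, hb.2 x hx]⟩
  smul_mem' := fun r c hc => ⟨T.smul_mem r hc.1, fun x hx => by
    rw [smul_mul_assoc, mul_smul_comm, hc.2 x hx]⟩

theorem finrank_commCenter_add_three_le [FiniteDimensional ℝ A] {T : Submodule ℝ A}
    (hbr : ∀ x ∈ T, ∀ y ∈ T, x * y - y * x ∈ T) {M : ℝ} (hM : ∀ x ∈ T, ‖exp x‖ ≤ M)
    (hnc : ∃ x ∈ T, ∃ y ∈ T, x * y ≠ y * x) :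
    Module.finrank ℝ (commCenter T) + 3 ≤ Module.finrank ℝ T := by
  obtain ⟨x, hx, y, hy, hxy⟩ := hnc
  by_contra hlt
  have hM' : ∀ x ∈ T, ∀ t : ℝ, ‖exp (t • x)‖ ≤ M := fun x hx t => hM _ (T.smul_mem t hx)
  have hCT : commCenter T ≤ T := fun c hc => hc.1
  have hspx : Submodule.span ℝ {x} ≤ T := by simpa
  have hspy : Submodule.span ℝ {y} ≤ T := by simpa
  have l1 : commCenter T < commCenter T ⊔ Submodule.span ℝ {x} := by
    refine lt_of_le_of_ne le_sup_left fun he => ?_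
    have : x ∈ commCenter T := he ▸ Submodule.mem_sup_right (Submodule.mem_span_singleton_self x)
    exact hxy (this.2 y hy)
  have l2 : commCenter T ⊔ Submodule.span ℝ {x} <
      commCenter T ⊔ Submodule.span ℝ {x} ⊔ Submodule.span ℝ {y} := by
    refine lt_of_le_of_ne le_sup_left fun he => ?_
    have : y ∈ commCenter T ⊔ Submodule.span ℝ {x} :=
      he ▸ Submodule.mem_sup_right (Submodule.mem_span_singleton_self y)
    obtain ⟨c, hc, z, hz, rfl⟩ := Submodule.mem_sup.1 this
    obtain ⟨r, rfl⟩ := Submodule.mem_span_singleton.1 hz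
    apply hxy
    rw [mul_add, add_mul, hc.2 x hx]; simp
  have l3 : commCenter T ⊔ Submodule.span ℝ {x} ⊔ Submodule.span ℝ {y} ≤ T :=
    sup_le (sup_le hCT hspx) hspy
  have f1 := Submodule.finrank_lt_finrank_of_lt l1
  have f2 := Submodule.finrank_lt_finrank_of_lt l2
  have l4 := Submodule.eq_of_le_of_finrank_le l3 (by omega)
  have hw : x * y - y * x ∈ commCenter T ⊔ Submodule.span ℝ {x} ⊔ Submodule.span ℝ {y} :=
    l4.ge (hbr x hx y hy)
  obtain ⟨u, hu, v, hv, huv⟩ := Submodule.mem_sup.1 hw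
  obtain ⟨b, rfl⟩ := Submodule.mem_span_singleton.1 hv
  obtain ⟨c, hc, v', hv', rfl⟩ := Submodule.mem_sup.1 hu
  obtain ⟨a, rfl⟩ := Submodule.mem_span_singleton.1 hv'
  set w := x * y - y * x with hwdef
  have hw0 : w ≠ 0 := sub_ne_zero.2 hxy
  have hxw : x * w - w * x = b • w := by
    rw [← huv, mul_add, mul_add, add_mul, add_mul, hc.2 x hx, huv, hwdef]
    simp only [mul_smul_comm, smul_mul_assoc, smul_sub]; abel
  have hb := eq_zero_of_bounded_ad (hM' x hx) hw0 hxw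
  rw [hb, zero_smul, sub_eq_zero] at hxw
  exact hw0 (commute_of_bounded_ad (hM' x hx) hwdef.symm hxw)

end CenterCodim

section Strata

variable {A : Type*} [NormedRing A] [NormedAlgebra ℝ A] [CompleteSpace A] [FiniteDimensional ℝ A]
  {G : Type*} [Group G] [TopologicalSpace G] [CompactSpace G]
  {ρ : G →* A} (hρ : Continuous ρ)

/-- The centralizer of a group element in the Lie algebra, as a subspace of the ambient algebra. -/
noncomputable def centA (g : G) : Submodule ℝ A := (cent hρ g).map (lieSub hρ).subtype

theorem mem_centA {g : G} {X : A} : X ∈ centA hρ g ↔ X ∈ lieSub hρ ∧ ρ g * X = X * ρ g := by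
  constructor
  · rintro ⟨Y, hY, rfl⟩
    exact ⟨Y.2, (mem_cent hρ).1 hY⟩
  · rintro ⟨h1, h2⟩
    exact ⟨⟨X, h1⟩, (mem_cent hρ).2 h2, rfl⟩

theorem finrank_centA (g : G) : Module.finrank ℝ (centA hρ g) = Module.finrank ℝ (cent hρ g) :=
  ((Submodule.equivMapOfInjective _ (lieSub hρ).injective_subtype (cent hρ g)).finrank_eq).symm

/-- An element is regular if its centralizer in the Lie algebra is commutative. -/
def IsReg (g : G) : Prop := ∀ x ∈ centA hρ g, ∀ y ∈ centA hρ g, x * y = y * x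

theorem finrank_commCenter_centA {g : G} (hg : ¬ IsReg hρ g) :
    Module.finrank ℝ (commCenter (centA hρ g)) + 3 ≤ Module.finrank ℝ (cent hρ g) := by
  obtain ⟨M, -, hM⟩ := exists_norm_le_rep hρ
  rw [← finrank_centA]
  refine finrank_commCenter_add_three_le (M := M) ?_ ?_ ?_
  · intro x hx y hy
    rw [mem_centA] at *
    refine ⟨commutator_mem_lieSub hρ hx.1 hy.1, ?_⟩
    have hc : Commute (ρ g) (x * y - y * x) :=
      (Commute.mul_right hx.2 hy.2).sub_right (Commute.mul_right hy.2 hx.2)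
    exact hc
  · intro x hx
    obtain ⟨k, hk⟩ := exp_mem_of_mem_lieSet ρ ((mem_centA hρ).1 hx).1
    rw [← hk]; exact hM k
  · simp only [IsReg] at hg
    push Not at hg
    exact hg

theorem map_expMap_inv {E : C(lieSub hρ, G)} (hE : ∀ X, ρ (E X) = exp (X : A)) (y : lieSub hρ) :
    ρ (E y)⁻¹ = exp (-(y : A)) := by
  refine left_inv_eq_right_inv (a := ρ (E y)) (map_inv_mul_map ρ _) ?_
  rw [hE, exp_mul_exp_neg]

theorem exists_slice_group [IsTopologicalGroup G] (hinj : Function.Injective ρ)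
    {E : C(lieSub hρ, G)} (hE : ∀ X, ρ (E X) = exp (X : A)) (g₀ : G) :
    ∃ Y τ : G → lieSub hρ, Y g₀ = 0 ∧ τ g₀ = 0 ∧
      (∀ g, Y g ∈ mv hρ g₀ ∧ τ g ∈ cent hρ g₀) ∧
      ∀ᶠ g in 𝓝 g₀, ContinuousAt Y g ∧ ContinuousAt τ g ∧
        g = E (Y g) * (g₀ * E (τ g)) * (E (Y g))⁻¹ ∧ cent hρ (g₀ * E (τ g)) ≤ cent hρ g₀ := by
  obtain ⟨Y, τ, hY0, hτ0, hYτ, hev⟩ := exists_slice hρ g₀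
  refine ⟨Y, τ, hY0, hτ0, hYτ, ?_⟩
  have hE0 : E 0 = 1 := hinj (by rw [hE]; simp [NormedSpace.exp_zero])
  have hτc : ContinuousAt τ g₀ := hev.self_of_nhds.2.1
  have hdisj : ∀ᶠ g in 𝓝 g₀, Disjoint (cent hρ (g₀ * E (τ g))) (mv hρ g₀) := by
    have : ContinuousAt (fun g => g₀ * E (τ g)) g₀ := by
      have : ContinuousAt (fun g => E (τ g)) g₀ := E.continuous.continuousAt.comp hτc
      fun_prop
    have h2 := this.tendsto
    simp only [hτ0, hE0, mul_one] at h2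
    exact h2.eventually (eventually_cent_disjoint_mv hρ g₀)
  filter_upwards [hev, hdisj] with g hg hd
  obtain ⟨hYc, hτc, hg⟩ := hg
  refine ⟨hYc, hτc, ?_, ?_⟩
  · apply hinj
    rw [hg, map_mul, map_mul, map_expMap_inv hρ hE, hE, map_mul, hE, mul_assoc (exp (Y g : A))]
  · have hcomm : g₀ * (g₀ * E (τ g)) = g₀ * E (τ g) * g₀ := by
      apply hinj
      simp only [map_mul, hE]
      have hc : Commute (ρ g₀) (τ g : A) := (mem_cent hρ).1 (hYτ g).2
      rw [mul_assoc, hc.exp_right.eq]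
    refine cent_le_cent_of_disjoint hρ (by rw [← map_mul, ← map_mul, hcomm]) hd fun X hX => ?_
    rw [mem_cent_iff_adL] at hX ⊢
    rw [← adL_mul, hcomm, adL_mul, hX]

/-- Elements near `g₀` whose centralizer has the same dimension lie in a small family. -/
theorem eventually_stratum [IsTopologicalGroup G] (hinj : Function.Injective ρ) (g₀ : G) :
    ∀ᶠ g in 𝓝 g₀, Module.finrank ℝ (cent hρ g) = Module.finrank ℝ (cent hρ g₀) →
      ∃ Y ∈ (mv hρ g₀).map (lieSub hρ).subtype, ∃ τ ∈ commCenter (centA hρ g₀),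
        ρ g = exp Y * ρ g₀ * exp τ * exp (-Y) := by
  obtain ⟨M, hM0, hM⟩ := exists_norm_le_rep hρ
  obtain ⟨E, hE⟩ := exists_expMap hρ hinj
  obtain ⟨Y, τ, hY0, hτ0, hYτ, hev⟩ := exists_slice_group hρ hinj hE g₀
  have hτc : ContinuousAt τ g₀ := hev.self_of_nhds.2.1
  obtain ⟨δ, hδ, hlog⟩ := Metric.eventually_nhds_iff.1 (logA_exp (A := A))
  have hsmall : ∀ᶠ g in 𝓝 g₀, M * ‖τ g‖ * M < δ := by
    have : ContinuousAt (fun g => M * ‖τ g‖ * M) g₀ := by fun_prop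
    have h2 := this.tendsto
    simp only [hτ0, norm_zero, mul_zero, zero_mul] at h2
    exact h2.eventually_lt_const hδ
  filter_upwards [hev, hsmall] with g hg hsm hfr
  obtain ⟨-, -, hgk, hle⟩ := hg
  obtain ⟨hYm, hτm⟩ := hYτ g
  generalize Y g = y at hgk hYm
  generalize τ g = t at hgk hτm hsm hle
  have hg : ρ g = exp (y : A) * ρ g₀ * exp (t : A) * exp (-(y : A)) := by
    rw [hgk, map_mul, map_mul, map_expMap_inv hρ hE, hE, map_mul, hE, ← mul_assoc (exp (y : A))]
  set h := g₀ * E t with hh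
  have hle2 : cent hρ g ≤ (cent hρ h).map (adL hρ (E y)) := fun X hX => by
    refine ⟨adL hρ (E y)⁻¹ X, ?_, by rw [← adL_mul, mul_inv_cancel, adL_one]⟩
    change adL hρ (E y)⁻¹ X ∈ cent hρ h
    rw [mem_cent_iff_adL] at hX ⊢
    rw [← adL_mul]
    conv_rhs => rw [← hX, ← adL_mul]
    congr 1
    rw [hgk]; group
  have heq : cent hρ h = cent hρ g₀ := by
    refine Submodule.eq_of_le_of_finrank_le hle ?_
    rw [← hfr]
    exact (Submodule.finrank_mono hle2).trans (Submodule.finrank_map_le _ _)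
  refine ⟨y, ⟨y, hYm, rfl⟩, t, ⟨⟨t, hτm, rfl⟩, ?_⟩, hg⟩
  rintro _ ⟨x, hx, rfl⟩
  change (t : A) * x = x * t
  have hxh : Commute (x : A) (exp (t : A)) := by
    have h1 : Commute (ρ g₀) (x : A) := (mem_cent hρ).1 hx
    have h2 : ρ h * x = x * ρ h := (mem_cent hρ).1 (heq ▸ hx)
    rw [hh, map_mul, hE, mul_assoc, ← mul_assoc (x : A), ← h1.eq, mul_assoc] at h2
    have h3 := congrArg (ρ g₀⁻¹ * ·) h2
    simp only [← mul_assoc, map_inv_mul_map, one_mul] at h3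
    exact h3.symm
  have hconst : ∀ s : ℝ, exp (s • (x : A)) * t * exp (s • (-(x : A))) = t := by
    intro s
    have e1 : exp (s • (x : A)) * exp (s • (-(x : A))) = 1 := by rw [smul_neg, exp_mul_exp_neg]
    have e2 : exp (s • (-(x : A))) * exp (s • (x : A)) = 1 := by rw [smul_neg, exp_neg_mul_exp]
    have e3 : exp (exp (s • (x : A)) * t * exp (s • (-(x : A)))) = exp (t : A) := by
      rw [exp_conj e1 e2]
      have : Commute (exp (s • (x : A))) (exp (t : A)) := (hxh.smul_left s).exp_left
      rw [this.eq, mul_assoc, e1, mul_one]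
    have hb : ∀ s : ℝ, ‖exp (s • (x : A))‖ ≤ M := fun s => by
      obtain ⟨k, hk⟩ := x.2 s
      rw [← hk]; exact hM k
    have hb' : ‖exp (s • (-(x : A)))‖ ≤ M := by
      have := hb (-s); rwa [neg_smul, ← smul_neg] at this
    have hsm1 : ‖exp (s • (x : A)) * t * exp (s • (-(x : A)))‖ < δ := by
      refine lt_of_le_of_lt ?_ hsm
      refine (norm_mul_le _ _).trans ?_
      gcongr
      exact (norm_mul_le _ _).trans (by gcongr; exacts [hb s, le_rfl])
    have hsm2 : ‖(t : A)‖ < δ := by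
      refine lt_of_le_of_lt ?_ hsm
      calc ‖(t : A)‖ = ‖ρ 1 * t * ρ 1‖ := by simp
        _ ≤ M * ‖t‖ * M := by
          refine (norm_mul_le _ _).trans ?_
          gcongr
          · exact (norm_mul_le _ _).trans (by gcongr; exacts [hM 1, le_rfl])
          · exact hM 1
    have e4 := hlog (y := (t : A)) (by simpa using hsm2)
    rw [← e3] at e4
    exact (hlog (by simpa using hsm1)).symm.trans e4
  have hd0 := hasDerivAt_conj (x : A) (t : A) 0
  simp only [hconst, zero_smul, NormedSpace.exp_zero, one_mul, mul_one] at hd0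
  have := hd0.unique (hasDerivAt_const (0 : ℝ) (t : A))
  exact (sub_eq_zero.1 this).symm

end Strata

section Avoid

variable {A : Type*} [NormedRing A] [NormedAlgebra ℝ A] [CompleteSpace A] [FiniteDimensional ℝ A]
  {G : Type*} [Group G] [TopologicalSpace G] [CompactSpace G]
  {ρ : G →* A} (hρ : Continuous ρ)

theorem dimH_image_le_of_contDiff {E F : Type*} [NormedAddCommGroup E] [NormedSpace ℝ E]
    [FiniteDimensional ℝ E] [NormedAddCommGroup F] [NormedSpace ℝ F] {f : E → F}
    (hf : ContDiff ℝ 1 f) (s : Set E) : dimH (f '' s) ≤ dimH s := by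
  have : ProperSpace E := FiniteDimensional.proper ℝ E
  refine dimH_image_le_of_locally_lipschitzOn fun x _ => ?_
  obtain ⟨C, t, ht, h⟩ := hf.locallyLipschitz x
  exact ⟨C, t, mem_nhdsWithin_of_mem_nhds ht, h⟩

theorem dimH_mul_image_le {E P : Type*} [NormedAddCommGroup E] [NormedSpace ℝ E]
    [FiniteDimensional ℝ E] [NormedAddCommGroup P] [NormedSpace ℝ P] [FiniteDimensional ℝ P]
    {Q : Set E} {ψ : E → A} (hψ : ∀ x ∈ Q, ∃ C, ∃ t ∈ 𝓝[Q] x, LipschitzOnWith C ψ t)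
    {Φ : P → A} (hΦ : ContDiff ℝ 1 Φ) :
    dimH {a : A | ∃ u ∈ Q, ∃ p, a = ψ u * Φ p} ≤ (Module.finrank ℝ E + Module.finrank ℝ P : ℕ) := by
  have : ProperSpace E := FiniteDimensional.proper ℝ E
  have : ProperSpace P := FiniteDimensional.proper ℝ P
  have h1 : {a : A | ∃ u ∈ Q, ∃ p, a = ψ u * Φ p} =
      (fun z : A × A => z.1 * z.2) '' ((fun z : E × P => (ψ z.1, Φ z.2)) '' (Q ×ˢ univ)) := by
    ext a
    constructor
    · rintro ⟨u, hu, p, rfl⟩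
      exact ⟨_, ⟨(u, p), ⟨hu, trivial⟩, rfl⟩, rfl⟩
    · rintro ⟨_, ⟨⟨u, p⟩, ⟨hu, -⟩, rfl⟩, rfl⟩
      exact ⟨u, hu, p, rfl⟩
  rw [h1]
  refine (dimH_image_le_of_contDiff contDiff_mul _).trans ?_
  have h2 : dimH ((fun z : E × P => (ψ z.1, Φ z.2)) '' (Q ×ˢ univ)) ≤ dimH (Q ×ˢ (univ : Set P)) := by
    refine dimH_image_le_of_locally_lipschitzOn ?_
    rintro ⟨x, p⟩ ⟨hx, -⟩
    obtain ⟨C, t, ht, h⟩ := hψ x hx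
    obtain ⟨C', t', ht', h'⟩ := hΦ.locallyLipschitz p
    refine ⟨_, t ×ˢ t', ?_, (h.comp (LipschitzWith.prod_fst.lipschitzOnWith (s := t ×ˢ t'))
      fun z hz => hz.1).prodMk (h'.comp (LipschitzWith.prod_snd.lipschitzOnWith (s := t ×ˢ t'))
      fun z hz => hz.2)⟩
    rw [nhdsWithin_prod_eq, nhdsWithin_univ]
    exact prod_mem_prod ht ht'
  refine h2.trans ((dimH_mono (subset_univ _)).trans ?_)
  rw [Real.dimH_univ_eq_finrank, Module.finrank_prod]

/-- The parametrisation of a stratum of singular elements. -/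
noncomputable def stratumMap (g₀ : G)
    (p : (mv hρ g₀).map (lieSub hρ).subtype × commCenter (centA hρ g₀)) : A :=
  exp (p.1 : A) * ρ g₀ * exp (p.2 : A) * exp (-(p.1 : A))

theorem contDiff_stratumMap (g₀ : G) : ContDiff ℝ 1 (stratumMap hρ g₀) := by
  have h1 : ContDiff ℝ 1 (fun p : (mv hρ g₀).map (lieSub hρ).subtype × commCenter (centA hρ g₀) =>
      (p.1 : A)) :=
    ((mv hρ g₀).map (lieSub hρ).subtype).subtypeL.contDiff.comp contDiff_fst
  have h2 : ContDiff ℝ 1 (fun p : (mv hρ g₀).map (lieSub hρ).subtype × commCenter (centA hρ g₀) =>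
      (p.2 : A)) :=
    (commCenter (centA hρ g₀)).subtypeL.contDiff.comp contDiff_snd
  exact (((contDiff_exp.comp h1).mul contDiff_const).mul (contDiff_exp.comp h2)).mul
    (contDiff_exp.comp h1.neg)

theorem finrank_stratum {g₀ : G} (hg : ¬ IsReg hρ g₀) :
    2 + Module.finrank ℝ ((mv hρ g₀).map (lieSub hρ).subtype × commCenter (centA hρ g₀)) + 1
      ≤ Module.finrank ℝ (lieSub hρ) := by
  have h1 := finrank_commCenter_centA hρ hg
  have h2 := finrank_mv_add_finrank_cent hρ g₀
  have h3 := Submodule.finrank_map_le (lieSub hρ).subtype (mv hρ g₀)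
  rw [Module.finrank_prod]
  omega

theorem dimH_singular_le [IsTopologicalGroup G] (hinj : Function.Injective ρ) {ι : Type*} [Countable ι]
    (Q : ι → Set (Fin 2 → ℝ)) (ψ : ι → (Fin 2 → ℝ) → A)
    (hψ : ∀ i, ∀ x ∈ Q i, ∃ C, ∃ t ∈ 𝓝[Q i] x, LipschitzOnWith C (ψ i) t) :
    dimH {a : A | ∃ i, ∃ u ∈ Q i, ∃ s, ¬ IsReg hρ s ∧ a = ψ i u * ρ s} ≤
      (Module.finrank ℝ (lieSub hρ) - 1 : ℕ) := by
  have : ProperSpace A := FiniteDimensional.proper ℝ A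
  have : SecondCountableTopology G := (isClosedEmbedding_rep hρ hinj).isEmbedding.secondCountableTopology
  let S : ℕ → Set G := fun j => {g | ¬ IsReg hρ g ∧ Module.finrank ℝ (cent hρ g) = j}
  let V : G → Set G := fun g₀ => {g | ρ g ∈ range (stratumMap hρ g₀)}
  have hcov : ∀ j, ∃ t ⊆ S j, t.Countable ∧ S j ⊆ ⋃ x ∈ t, V x := fun j => by
    refine TopologicalSpace.countable_cover_nhdsWithin fun g₀ hg₀ => ?_
    rw [mem_nhdsWithin_iff_eventually]
    filter_upwards [eventually_stratum hρ hinj g₀] with g hg hgS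
    obtain ⟨Y, hY, τ, hτ, h⟩ := hg (hgS.2.trans hg₀.2.symm)
    exact ⟨(⟨Y, hY⟩, ⟨τ, hτ⟩), h.symm⟩
  choose t htS htc htV using hcov
  have hsub : {a : A | ∃ i, ∃ u ∈ Q i, ∃ s, ¬ IsReg hρ s ∧ a = ψ i u * ρ s} ⊆
      ⋃ i, ⋃ j, ⋃ g₀ ∈ t j, {a : A | ∃ u ∈ Q i, ∃ p, a = ψ i u * stratumMap hρ g₀ p} := by
    rintro a ⟨i, u, hu, s, hs, rfl⟩
    have := htV _ (show s ∈ S _ from ⟨hs, rfl⟩)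
    simp only [mem_iUnion] at this ⊢
    obtain ⟨g₀, hg₀, p, hp⟩ := this
    exact ⟨i, _, g₀, hg₀, u, hu, p, by rw [hp]⟩
  refine (dimH_mono hsub).trans ?_
  rw [dimH_iUnion]
  refine iSup_le fun i => ?_
  rw [dimH_iUnion]
  refine iSup_le fun j => ?_
  rw [dimH_bUnion (htc j)]
  refine iSup₂_le fun g₀ hg₀ => ?_
  refine (dimH_mul_image_le (hψ i) (contDiff_stratumMap hρ g₀)).trans ?_
  have := finrank_stratum hρ (htS j hg₀).1
  rw [Module.finrank_fin_fun]
  exact_mod_cast (by omega)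

/-- A generic small translation moves a two-dimensional family off the singular set. -/
theorem exists_avoid [IsTopologicalGroup G] (hinj : Function.Injective ρ) {ι : Type*} [Countable ι]
    (Q : ι → Set (Fin 2 → ℝ)) (ψ : ι → (Fin 2 → ℝ) → A)
    (hψ : ∀ i, ∀ x ∈ Q i, ∃ C, ∃ t ∈ 𝓝[Q i] x, LipschitzOnWith C (ψ i) t)
    (hne : ∃ s, ¬ IsReg hρ s) {U : Set (lieSub hρ)} (hU : U ∈ 𝓝 0) :
    ∃ X ∈ U, ∀ i, ∀ u ∈ Q i, ∀ s, ¬ IsReg hρ s → exp (X : A) ≠ ψ i u * ρ s := by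
  set D := {a : A | ∃ i, ∃ u ∈ Q i, ∃ s, ¬ IsReg hρ s ∧ a = ψ i u * ρ s} with hD
  have hdim := dimH_singular_le hρ hinj Q ψ hψ
  rw [← hD] at hdim
  have hpos : 1 ≤ Module.finrank ℝ (lieSub hρ) := by
    obtain ⟨s, hs⟩ := hne
    have := finrank_stratum hρ hs
    omega
  obtain ⟨K, s, hs, hK⟩ := (exp_hasStrictFDerivAt_zero (A := A)).to_localInverse.exists_lipschitzOnWith
  rw [NormedSpace.exp_zero] at hs
  change LipschitzOnWith K (logA : A → A) s at hK
  have he : Tendsto (fun X : lieSub hρ => exp (X : A)) (𝓝 0) (𝓝 1) := by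
    have : Continuous (fun X : lieSub hρ => exp (X : A)) := continuous_exp.comp continuous_subtype_val
    exact this.tendsto' _ _ (by simp [NormedSpace.exp_zero])
  have hc : Tendsto (fun X : lieSub hρ => (X : A)) (𝓝 0) (𝓝 0) :=
    continuous_subtype_val.tendsto' _ _ rfl
  have hev : ∀ᶠ X : lieSub hρ in 𝓝 0, X ∈ U ∧ exp (X : A) ∈ s ∧ logA (exp (X : A)) = X :=
    Filter.Eventually.and hU (Filter.Eventually.and (he hs) (hc.eventually logA_exp))
  obtain ⟨V, hV, hVo, hV0⟩ := mem_nhds_iff.1 hev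
  set W := {X : lieSub hρ | X ∈ V ∧ exp (X : A) ∈ D} with hW
  have hdW : dimH W < Module.finrank ℝ (lieSub hρ) := by
    have h1 : dimH W = dimH (((↑) : lieSub hρ → A) '' W) := (isometry_subtype_coe.dimH_image W).symm
    have h2 : ((↑) : lieSub hρ → A) '' W ⊆ logA '' (D ∩ s) := by
      rintro _ ⟨X, ⟨hX, hXD⟩, rfl⟩
      exact ⟨exp (X : A), ⟨hXD, (hV hX).2.1⟩, (hV hX).2.2⟩
    calc dimH W ≤ dimH (logA '' (D ∩ s)) := h1 ▸ dimH_mono h2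
      _ ≤ dimH (D ∩ s) := (hK.mono inter_subset_right).dimH_image_le
      _ ≤ dimH D := dimH_mono inter_subset_left
      _ ≤ _ := hdim
      _ < _ := by exact_mod_cast (by omega)
  obtain ⟨X, hXW, hXV⟩ := (dense_compl_of_dimH_lt_finrank hdW).exists_mem_open hVo ⟨0, hV0⟩
  refine ⟨X, (hV hXV).1, fun i u hu s hs h => hXW ⟨hXV, i, u, hu, s, hs, h⟩⟩

end Avoid

section Cover

variable {A : Type*} [NormedRing A] [NormedAlgebra ℝ A] [CompleteSpace A] [FiniteDimensional ℝ A]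
  {G : Type*} [Group G] [TopologicalSpace G] [CompactSpace G]
  {ρ : G →* A} (hρ : Continuous ρ)

theorem mem_cent_of_expMap_eq {E : C(lieSub hρ, G)} (hE : ∀ X, ρ (E X) = exp (X : A)) {g : G}
    {X : lieSub hρ} (h : E X = g) : X ∈ cent hρ g := by
  rw [mem_cent, ← h, hE]
  exact ((Commute.refl (X : A)).exp_left)

theorem commute_of_isReg {g : G} (hg : IsReg hρ g) {X Y : lieSub hρ} (hX : X ∈ cent hρ g)
    (hY : Y ∈ cent hρ g) : Commute (X : A) (Y : A) :=
  hg _ ⟨X, hX, rfl⟩ _ ⟨Y, hY, rfl⟩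

theorem expMap_adL (hinj : Function.Injective ρ) {E : C(lieSub hρ, G)}
    (hE : ∀ X, ρ (E X) = exp (X : A)) (g : G) (X : lieSub hρ) :
    E (adL hρ g X) = g * E X * g⁻¹ := by
  apply hinj
  rw [hE, map_mul, map_mul, hE, coe_adL, exp_conj (map_mul_map_inv ρ g) (map_inv_mul_map ρ g)]

theorem expMap_add (hinj : Function.Injective ρ) {E : C(lieSub hρ, G)}
    (hE : ∀ X, ρ (E X) = exp (X : A)) {X Y : lieSub hρ} (h : Commute (X : A) (Y : A)) :
    E (X + Y) = E X * E Y := by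
  apply hinj
  rw [hE, map_mul, hE, hE, Submodule.coe_add, exp_add_of_commute h]

theorem expMap_neg (hinj : Function.Injective ρ) {E : C(lieSub hρ, G)}
    (hE : ∀ X, ρ (E X) = exp (X : A)) (X : lieSub hρ) : E (-X) = (E X)⁻¹ := by
  apply hinj
  rw [hE, map_expMap_inv hρ hE, Submodule.coe_neg]

theorem discreteTopology_fiber (hinj : Function.Injective ρ) {E : C(lieSub hρ, G)}
    (hE : ∀ X, ρ (E X) = exp (X : A)) {g₀ : G}
    (hg : IsReg hρ g₀) : DiscreteTopology (E ⁻¹' {g₀}) := by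
  rw [discreteTopology_subtype_iff']
  intro σ hσ
  have hev : ∀ᶠ X : lieSub hρ in 𝓝 σ, logA (exp ((X - σ : lieSub hρ) : A)) = (X - σ : lieSub hρ) := by
    have h0 : Tendsto (fun X : lieSub hρ => ((X - σ : lieSub hρ) : A)) (𝓝 σ) (𝓝 0) := by
      have : Continuous (fun X : lieSub hρ => ((X - σ : lieSub hρ) : A)) := by fun_prop
      exact this.tendsto' _ _ (by simp)
    exact h0.eventually logA_exp
  obtain ⟨V, hV, hVo, hV0⟩ := mem_nhds_iff.1 hev
  refine ⟨V, hVo, Subset.antisymm ?_ (singleton_subset_iff.2 ⟨hV0, hσ⟩)⟩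
  rintro X ⟨hXV, hX⟩
  have h1 : E (X - σ) = 1 := by
    rw [sub_eq_add_neg, expMap_add hρ hinj hE, expMap_neg hρ hinj hE, show E X = g₀ from hX,
      show E σ = g₀ from hσ, mul_inv_cancel]
    rw [Submodule.coe_neg]
    exact (commute_of_isReg hρ hg (mem_cent_of_expMap_eq hρ hE hX)
      (mem_cent_of_expMap_eq hρ hE hσ)).neg_right
  have h2 := hV hXV
  rw [mem_ofPred_eq, ← hE, h1, map_one, logA_one] at h2
  have h3 : X - σ = 0 := Subtype.ext h2.symm
  exact sub_eq_zero.1 h3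

theorem continuous_adL [IsTopologicalGroup G] :
    Continuous fun p : G × lieSub hρ => adL hρ p.1 p.2 := by
  refine Continuous.subtype_mk (f := fun p : G × lieSub hρ => ρ p.1 * (p.2 : A) * ρ p.1⁻¹) ?_ _
  have h1 : Continuous fun p : G × lieSub hρ => ρ p.1 := hρ.comp continuous_fst
  have h2 : Continuous fun p : G × lieSub hρ => ρ p.1⁻¹ := hρ.comp continuous_fst.inv
  have h3 : Continuous fun p : G × lieSub hρ => (p.2 : A) := continuous_subtype_val.comp continuous_snd
  exact (h1.mul h3).mul h2

/-- The exponential map is a covering over the set of regular elements. -/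
theorem isCoveringMapOn_expMap [IsTopologicalGroup G] (hinj : Function.Injective ρ) {E : C(lieSub hρ, G)}
    (hE : ∀ X, ρ (E X) = exp (X : A)) : IsCoveringMapOn E {g | IsReg hρ g} := by
  intro g₀ hg₀
  refine ⟨discreteTopology_fiber hρ hinj hE hg₀, ?_⟩
  obtain ⟨Y, τ, -, -, hYτ, hev⟩ := exists_slice_group hρ hinj hE g₀
  obtain ⟨U, hU, hUo, hU0⟩ := mem_nhds_iff.1 hev
  have hc : ∀ {X Z : lieSub hρ}, X ∈ cent hρ g₀ → Z ∈ cent hρ g₀ → Commute (X : A) (Z : A) :=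
    fun hX hZ => commute_of_isReg hρ hg₀ hX hZ
  have hYc : Continuous fun g : U => Y g :=
    continuous_iff_continuousAt.2 fun g => (hU g.2).1.comp continuous_subtype_val.continuousAt
  have hτc : Continuous fun g : U => τ g :=
    continuous_iff_continuousAt.2 fun g => (hU g.2).2.1.comp continuous_subtype_val.continuousAt
  have hlog : ∀ X : lieSub hρ, E X ∈ U →
      E (adL hρ (E (Y (E X)))⁻¹ X) = g₀ * E (τ (E X)) := fun X hX => by
    rw [expMap_adL hρ hinj hE]
    conv_lhs => enter [1, 2]; rw [(hU hX).2.2.1]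
    group
  have hfib : ∀ X : lieSub hρ, E X ∈ U →
      E (adL hρ (E (Y (E X)))⁻¹ X - τ (E X)) = g₀ := fun X hX => by
    have h1 := (hU hX).2.2.2 (mem_cent_of_expMap_eq hρ hE (hlog X hX))
    rw [sub_eq_add_neg, expMap_add hρ hinj hE (by
      rw [Submodule.coe_neg]; exact (hc h1 (hYτ _).2).neg_right), hlog X hX, expMap_neg hρ hinj hE]
    group
  have hinv : ∀ g ∈ U, ∀ σ : lieSub hρ, E σ = g₀ → E (adL hρ (E (Y g)) (σ + τ g)) = g :=
    fun g hg σ hσ => by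
      rw [expMap_adL hρ hinj hE, expMap_add hρ hinj hE
        (hc (mem_cent_of_expMap_eq hρ hE hσ) (hYτ g).2), hσ]
      exact (hU hg).2.2.1.symm
  refine ⟨U, hU0, hUo, hUo.preimage E.continuous,
    { toFun := fun X => (⟨E X, X.2⟩, ⟨adL hρ (E (Y (E X)))⁻¹ X - τ (E X), hfib X X.2⟩)
      invFun := fun p => ⟨adL hρ (E (Y p.1)) (p.2 + τ p.1), by
        rw [mem_preimage, hinv _ p.1.2 _ p.2.2]; exact p.1.2⟩
      left_inv := ?_
      right_inv := ?_
      continuous_toFun := ?_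
      continuous_invFun := ?_ }, fun _ => rfl⟩
  · intro X
    apply Subtype.ext
    simp only [sub_add_cancel]
    rw [← adL_mul, mul_inv_cancel, adL_one]
  · rintro ⟨g, σ⟩
    have h := hinv g g.2 σ σ.2
    refine Prod.ext (Subtype.ext h) (Subtype.ext ?_)
    simp only [h]
    rw [← adL_mul, inv_mul_cancel, adL_one, add_sub_cancel_right]
  · have h1 : Continuous fun X : E ⁻¹' U => (⟨E X, X.2⟩ : U) := by fun_prop
    refine h1.prodMk (Continuous.subtype_mk ?_ _)
    have h2 : Continuous fun X : E ⁻¹' U => (E (Y (E X)))⁻¹ :=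
      (E.continuous.comp (hYc.comp h1)).inv
    exact ((continuous_adL hρ).comp (h2.prodMk continuous_subtype_val)).sub (hτc.comp h1)
  · refine Continuous.subtype_mk ?_ _
    have h2 : Continuous fun p : U × (E ⁻¹' {g₀}) => E (Y p.1) :=
      E.continuous.comp (hYc.comp continuous_fst)
    have h3 : Continuous fun p : U × (E ⁻¹' {g₀}) => (p.2 : lieSub hρ) + τ p.1 :=
      (continuous_subtype_val.comp continuous_snd).add (hτc.comp continuous_fst)
    exact (continuous_adL hρ).comp (h2.prodMk h3)

end Cover

section Glue

theorem exists_glue {B E : Type*} [TopologicalSpace B] [TopologicalSpace E] {D₁ D₂ : Set B}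
    (h₁ : IsClosed D₁) (h₂ : IsClosed D₂) (hU : D₁ ∪ D₂ = univ) (F₁ : C(D₁, E)) (F₂ : C(D₂, E))
    (h : ∀ x hx hx', F₁ ⟨x, hx⟩ = F₂ ⟨x, hx'⟩) :
    ∃ F : C(B, E), (∀ x hx, F x = F₁ ⟨x, hx⟩) ∧ ∀ x hx, F x = F₂ ⟨x, hx⟩ := by
  classical
  have hmem : ∀ x, x ∉ D₁ → x ∈ D₂ := fun x hx =>
    (hU.symm ▸ mem_univ x : x ∈ D₁ ∪ D₂).resolve_left hx
  let φ : B → E := fun x => if hx : x ∈ D₁ then F₁ ⟨x, hx⟩ else F₂ ⟨x, hmem x hx⟩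
  have e₁ : ∀ x hx, φ x = F₁ ⟨x, hx⟩ := fun x hx => dif_pos hx
  have e₂ : ∀ x hx, φ x = F₂ ⟨x, hx⟩ := by
    intro x hx
    by_cases hx₁ : x ∈ D₁
    · rw [e₁ x hx₁, h x hx₁ hx]
    · exact dif_neg hx₁
  have c₁ : ContinuousOn φ D₁ := by
    rw [continuousOn_iff_continuous_domRestrict]
    exact F₁.continuous.congr fun x => (e₁ x x.2).symm
  have c₂ : ContinuousOn φ D₂ := by
    rw [continuousOn_iff_continuous_domRestrict]
    exact F₂.continuous.congr fun x => (e₂ x x.2).symm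
  have c := c₁.union_of_isClosed c₂ h₁ h₂
  rw [hU, continuousOn_univ] at c
  exact ⟨⟨φ, c⟩, e₁, e₂⟩

end Glue

section Lift

variable {V : Type*} [AddCommGroup V] [Module ℝ V] [TopologicalSpace V] [ContinuousAdd V]
  [ContinuousSMul ℝ V] {E X : Type*} [TopologicalSpace E] [TopologicalSpace X] {p : E → X}

theorem exists_contraction {D : Set V} {b : V} (hb : b ∈ D) (hD : StarConvex ℝ b D) :
    ∃ c : C(unitInterval × D, D), (∀ x, c (0, x) = ⟨b, hb⟩) ∧ ∀ x, c (1, x) = x := by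
  refine ⟨⟨fun q => ⟨(1 - (q.1 : ℝ)) • b + (q.1 : ℝ) • (q.2 : V),
    hD q.2.2 (by linarith [q.1.2.2]) q.1.2.1 (by ring)⟩, by fun_prop⟩, fun x => ?_, fun x => ?_⟩
  · simp
  · simp

theorem exists_lift_of_starConvex (cov : IsCoveringMap p) {D : Set V} {b : V} (hb : b ∈ D)
    (hD : StarConvex ℝ b D) (f : C(D, X)) (b₁ : D) {e : E} (he : p e = f b₁) :
    ∃ F : C(D, E), p ∘ F = f ∧ F b₁ = e := by
  obtain ⟨c, c0, c1⟩ := exists_contraction hb hD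
  have e1 : c (unitInterval.symm 0, b₁) = b₁ := by simp [c1]
  obtain ⟨Γ, hΓ, hΓ0⟩ := cov.exists_path_lifts
    ⟨fun t => f (c (unitInterval.symm t, b₁)), by fun_prop⟩ e (by simp [c1, he])
  have hH0 : ∀ a : D, (f.comp c) (0, a) = p (Γ 1) := by
    intro a
    have := congrFun hΓ 1
    simp only [Function.comp, ContinuousMap.coe_mk, unitInterval.symm_one] at this
    simp [this, c0]
  let L := cov.liftHomotopy (f.comp c) (ContinuousMap.const D (Γ 1)) hH0
  have hL : p ∘ L = f.comp c := cov.liftHomotopy_lifts _ _ _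
  have hL0 : ∀ a, L (0, a) = Γ 1 := fun a => cov.liftHomotopy_zero _ _ hH0 a
  refine ⟨⟨fun x => L (1, x), by fun_prop⟩, ?_, ?_⟩
  · funext x
    have := congrFun hL (1, x)
    simpa [c1] using this
  · have key : (fun t => L (unitInterval.symm t, b₁)) = Γ := by
      refine cov.eq_of_comp_eq (by fun_prop) Γ.continuous ?_ 1 ?_
      · funext t
        have h1 := congrFun hL (unitInterval.symm t, b₁)
        have h2 := congrFun hΓ t
        simp only [Function.comp, ContinuousMap.coe_mk, ContinuousMap.comp_apply] at h1 h2 ⊢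
        rw [h1, h2]
      · simp [hL0]
    have := congrFun key 0
    simpa [hΓ0] using this

theorem exists_lift_of_union (cov : IsCoveringMap p) {B D₁ D₂ : Set V} (hB : B = D₁ ∪ D₂)
    (h₁ : IsClosed D₁) (h₂ : IsClosed D₂) {b₁ b₂ b : V} (hb₁ : b₁ ∈ D₁) (hb₂ : b₂ ∈ D₂)
    (hD₁ : StarConvex ℝ b₁ D₁) (hD₂ : StarConvex ℝ b₂ D₂) (hc : IsPreconnected (D₁ ∩ D₂))
    (hb : b ∈ D₁ ∩ D₂) (f : C(B, X)) {e : E} (he : p e = f ⟨b, hB ▸ Or.inl hb.1⟩) :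
    ∃ F : C(B, E), p ∘ F = f := by
  subst hB
  obtain ⟨F₁, hF₁, hF₁b⟩ := exists_lift_of_starConvex cov hb₁ hD₁
    ⟨fun x => f ⟨x, Or.inl x.2⟩, by fun_prop⟩ ⟨b, hb.1⟩ he
  obtain ⟨F₂, hF₂, hF₂b⟩ := exists_lift_of_starConvex cov hb₂ hD₂
    ⟨fun x => f ⟨x, Or.inr x.2⟩, by fun_prop⟩ ⟨b, hb.2⟩ he
  have : PreconnectedSpace ↥(D₁ ∩ D₂) := Subtype.preconnectedSpace hc
  have key : (fun x : ↥(D₁ ∩ D₂) => F₁ ⟨x, x.2.1⟩) = fun x : ↥(D₁ ∩ D₂) => F₂ ⟨x, x.2.2⟩ := by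
    refine cov.eq_of_comp_eq (by fun_prop) (by fun_prop) ?_ ⟨b, hb⟩ (by simp [hF₁b, hF₂b])
    funext x
    have h1 := congrFun hF₁ ⟨x, x.2.1⟩
    have h2 := congrFun hF₂ ⟨x, x.2.2⟩
    simp only [Function.comp, ContinuousMap.coe_mk] at h1 h2 ⊢
    rw [h1, h2]
  obtain ⟨F, e₁, e₂⟩ := exists_glue (B := ↥(D₁ ∪ D₂)) (E := E)
    (h₁.preimage continuous_subtype_val) (h₂.preimage continuous_subtype_val)
    (eq_univ_of_forall fun x => x.2)
    ⟨fun x => F₁ ⟨x, x.2⟩, by fun_prop⟩ ⟨fun x => F₂ ⟨x, x.2⟩, by fun_prop⟩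
    (fun x hx hx' => congrFun key ⟨x, hx, hx'⟩)
  refine ⟨F, funext fun x => ?_⟩
  rcases x.2 with hx | hx
  · have h1 := congrFun hF₁ ⟨x, hx⟩
    simp only [Function.comp, ContinuousMap.coe_mk] at h1 ⊢
    rw [e₁ x hx]
    exact h1
  · have h1 := congrFun hF₂ ⟨x, hx⟩
    simp only [Function.comp, ContinuousMap.coe_mk] at h1 ⊢
    rw [e₂ x hx]
    exact h1

end Lift

section Boundary

/-- The boundary of the standard simplex with vertices indexed by `Fin κ`. -/
def bd (κ : ℕ) : Set (Fin κ → ℝ) := {x | x ∈ stdSimplex ℝ (Fin κ) ∧ ∃ i, x i = 0}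

theorem isClosed_bd (κ : ℕ) : IsClosed (bd κ) := by
  have : bd κ = stdSimplex ℝ (Fin κ) ∩ ⋃ i, {x | x i = 0} := by
    ext x; simp [bd]
  rw [this]
  exact (isClosed_stdSimplex (𝕜 := ℝ) (Fin κ)).inter
    (isClosed_iUnion_of_finite fun i => isClosed_eq (continuous_apply i) continuous_const)

theorem single_mem_bd {κ : ℕ} {i j : Fin κ} (h : i ≠ j) : Pi.single i (1 : ℝ) ∈ bd κ :=
  ⟨single_mem_stdSimplex ℝ i, j, by simp [h.symm]⟩

theorem nullhomotopic_of_interval {B Y : Type*} [TopologicalSpace B] [TopologicalSpace Y]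
    (u : C(B, unitInterval)) (γ : C(unitInterval, Y)) : (γ.comp u).Nullhomotopic := by
  have : ContractibleSpace unitInterval :=
    (convex_Icc (0 : ℝ) 1).contractibleSpace ⟨0, by simp⟩
  have h : (ContinuousMap.id unitInterval).Nullhomotopic := id_nullhomotopic _
  simpa using (h.comp_left u).comp_right γ

end Boundary

section LowDim

variable {Y : Type*} [TopologicalSpace Y]

theorem continuous_coord {κ : ℕ} (i : Fin κ) : Continuous fun x : bd κ => x.1 i :=
  (continuous_apply i).comp continuous_subtype_val

theorem nullhomotopic_bd_one [Nonempty Y] (f : C(bd 1, Y)) : f.Nullhomotopic := by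
  have hE : IsEmpty (bd 1) := by
    constructor
    rintro ⟨x, ⟨-, h1⟩, i, hi⟩
    rw [Subsingleton.elim i 0] at hi
    simp [hi] at h1
  obtain ⟨y⟩ := ‹Nonempty Y›
  refine ⟨y, ?_⟩
  rw [show f = ContinuousMap.const _ y from ContinuousMap.ext fun x => hE.elim x]

theorem nullhomotopic_bd_two [PathConnectedSpace Y] (f : C(bd 2, Y)) : f.Nullhomotopic := by
  let γ := PathConnectedSpace.somePath (f ⟨_, single_mem_bd (i := 0) (j := 1) (by decide)⟩)
    (f ⟨_, single_mem_bd (i := 1) (j := 0) (by decide)⟩)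
  let u : C(bd 2, unitInterval) := ⟨fun x => ⟨x.1 1, x.2.1.1 1, by
    have := x.2.1.2
    have h0 := x.2.1.1 0
    simp only [Fin.sum_univ_two] at this
    linarith⟩, (continuous_coord 1).subtype_mk _⟩
  have hf : f = γ.toContinuousMap.comp u := by
    ext ⟨x, hx⟩
    have hs := hx.1.2
    simp only [Fin.sum_univ_two] at hs
    obtain ⟨i, hi⟩ := hx.2
    fin_cases i
    · have hi' : x 0 = 0 := hi
      have h1 : x 1 = 1 := by linarith
      have hu : u ⟨x, hx⟩ = 1 := Subtype.ext h1
      have hxe : x = Pi.single 1 1 := by ext j; fin_cases j <;> simp [hi', h1]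
      subst hxe
      exact (γ.target.symm.trans (congrArg γ hu.symm))
    · have hi' : x 1 = 0 := hi
      have h1 : x 0 = 1 := by linarith
      have hu : u ⟨x, hx⟩ = 0 := Subtype.ext hi'
      have hxe : x = Pi.single 0 1 := by ext j; fin_cases j <;> simp [hi', h1]
      subst hxe
      exact (γ.source.symm.trans (congrArg γ hu.symm))
  rw [hf]
  exact nullhomotopic_of_interval u _

theorem nullhomotopic_bd_three [SimplyConnectedSpace Y] (f : C(bd 3, Y)) : f.Nullhomotopic := by
  let u : C(bd 3, unitInterval) := ⟨fun x => ⟨(1 + x.1 2 - x.1 1) / 2, by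
    have := x.2.1.2
    have h0 := x.2.1.1 0
    have h1 := x.2.1.1 1
    have h2 := x.2.1.1 2
    simp only [Fin.sum_univ_three] at this
    constructor <;> linarith⟩,
    continuous_induced_rng.2
      (((continuous_const.add (continuous_coord 2)).sub (continuous_coord 1)).div_const 2)⟩
  let P : C(unitInterval, bd 3) := ⟨fun s => ⟨![0, 1 - s, s], ⟨by
      intro i
      have h0 := s.2.1
      have h1 := s.2.2
      fin_cases i <;> simp <;> linarith, by simp [Fin.sum_univ_three]⟩, 0, rfl⟩, by
    refine continuous_induced_rng.2 (continuous_pi fun i => ?_)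
    fin_cases i <;> simp <;> fun_prop⟩
  let Q : C(unitInterval, bd 3) := ⟨fun s => ⟨![1 - |2 * (s : ℝ) - 1|, max (1 - 2 * (s : ℝ)) 0,
      max (2 * (s : ℝ) - 1) 0], ⟨by
      intro i
      have h0 := s.2.1
      have h1 := s.2.2
      have : |2 * (s : ℝ) - 1| ≤ 1 := abs_le.2 ⟨by linarith, by linarith⟩
      fin_cases i
      · simpa using this
      · simp
      · simp, by
      simp only [Fin.sum_univ_three]
      rcases le_total (2 * (s : ℝ)) 1 with h | h
      · simp [abs_of_nonpos (sub_nonpos.2 h), max_eq_left (sub_nonneg.2 h),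
          max_eq_right (sub_nonpos.2 h)]
      · simp [abs_of_nonneg (sub_nonneg.2 h), max_eq_right (sub_nonpos.2 h),
          max_eq_left (sub_nonneg.2 h)]⟩, by
      rcases le_total (2 * (s : ℝ)) 1 with h | h
      · exact ⟨2, max_eq_right (sub_nonpos.2 h)⟩
      · exact ⟨1, max_eq_right (sub_nonpos.2 h)⟩⟩, by
    refine continuous_induced_rng.2 (continuous_pi fun i => ?_)
    fin_cases i <;> simp <;> fun_prop⟩
  let p : Path (f (P 0)) (f (P 1)) := ⟨f.comp P, rfl, rfl⟩
  have hQ0 : Q 0 = P 0 := Subtype.ext (by ext i; fin_cases i <;> simp [P, Q])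
  have hQ1 : Q 1 = P 1 := Subtype.ext (by ext i; fin_cases i <;> norm_num [P, Q])
  let q : Path (f (P 0)) (f (P 1)) := ⟨f.comp Q, by simp [hQ0], by simp [hQ1]⟩
  obtain ⟨H⟩ := SimplyConnectedSpace.paths_homotopic q p
  let D₁ : Set (bd 3) := {x | x.1 0 = 0}
  let D₂ : Set (bd 3) := {x | x.1 1 = 0 ∨ x.1 2 = 0}
  have hD₁ : IsClosed D₁ := isClosed_eq (continuous_coord 0) continuous_const
  have hD₂ : IsClosed D₂ :=
    (isClosed_eq (continuous_coord 1) continuous_const).union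
      (isClosed_eq (continuous_coord 2) continuous_const)
  have hP : ∀ x ∈ D₁, P (u x) = x := by
    intro x hx
    have hx0 : x.1 0 = 0 := hx
    have := x.2.1.2
    simp only [Fin.sum_univ_three] at this
    refine Subtype.ext ?_
    ext i
    fin_cases i
    · simp [P, hx0]
    · simp [P, u]; linarith
    · simp [P, u]; linarith
  have hQ : ∀ x ∈ D₂, Q (u x) = x := by
    intro x hx
    have hs := x.2.1.2
    have h1 := x.2.1.1 1
    have h2 := x.2.1.1 2
    simp only [Fin.sum_univ_three] at hs
    refine Subtype.ext ?_
    have e1 : 2 * ((u x : unitInterval) : ℝ) - 1 = x.1 2 - x.1 1 := by simp [u]; ring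
    have e2 : 1 - 2 * ((u x : unitInterval) : ℝ) = x.1 1 - x.1 2 := by simp [u]; ring
    have hQx : (Q (u x)).1 = ![1 - |x.1 2 - x.1 1|, max (x.1 1 - x.1 2) 0,
        max (x.1 2 - x.1 1) 0] := by
      rw [← e1, ← e2]
      rfl
    rw [hQx]
    rcases hx with hx | hx
    · ext i
      fin_cases i <;> simp [hx, abs_of_nonneg h2, h2]
      linarith
    · ext i
      fin_cases i <;> simp [hx, abs_of_nonneg h1, h1]
      linarith
  let F₁ : C((Prod.snd ⁻¹' D₁ : Set (unitInterval × bd 3)), Y) :=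
    ⟨fun x => p (u x.1.2), by fun_prop⟩
  let F₂ : C((Prod.snd ⁻¹' D₂ : Set (unitInterval × bd 3)), Y) :=
    ⟨fun x => H (x.1.1, u x.1.2), by fun_prop⟩
  obtain ⟨K, K₁, K₂⟩ := exists_glue (B := unitInterval × bd 3) (E := Y)
    (hD₁.preimage continuous_snd) (hD₂.preimage continuous_snd)
    (eq_univ_of_forall fun x => by
      obtain ⟨i, hi⟩ := x.2.2.2
      fin_cases i
      · exact Or.inl hi
      · exact Or.inr (Or.inl hi)
      · exact Or.inr (Or.inr hi))
    F₁ F₂ (by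
      rintro ⟨t, x⟩ hx hx'
      have hx0 : x.1 0 = 0 := hx
      have hs := x.2.1.2
      simp only [Fin.sum_univ_three] at hs
      rcases hx' with h | h
      · have : u x = 1 := Subtype.ext (by
          have h' : x.1 1 = 0 := h
          simp [u]; linarith)
        change p (u x) = H (t, u x)
        rw [this]
        exact p.target.trans (H.target t).symm
      · have : u x = 0 := Subtype.ext (by
          have h' : x.1 2 = 0 := h
          simp [u]; linarith)
        change p (u x) = H (t, u x)
        rw [this]
        exact p.source.trans (H.source t).symm)
  have hhom : f.Homotopic (p.toContinuousMap.comp u) := by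
    refine ⟨⟨K, fun x => ?_, fun x => ?_⟩⟩
    · by_cases hx : x ∈ D₁
      · have hK : K (0, x) = p (u x) := K₁ (0, x) hx
        exact hK.trans (congrArg f (hP x hx))
      · have hx₂ : x ∈ D₂ := by
          obtain ⟨i, hi⟩ := x.2.2
          fin_cases i
          · exact (hx hi).elim
          · exact Or.inl hi
          · exact Or.inr hi
        have hK : K (0, x) = H (0, u x) := K₂ (0, x) hx₂
        have hq : q (u x) = f x := congrArg f (hQ x hx₂)
        exact hK.trans ((H.apply_zero _).trans hq)
    · by_cases hx : x ∈ D₁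
      · exact K₁ (1, x) hx
      · have hx₂ : x ∈ D₂ := by
          obtain ⟨i, hi⟩ := x.2.2
          fin_cases i
          · exact (hx hi).elim
          · exact Or.inl hi
          · exact Or.inr hi
        have hK : K (1, x) = H (1, u x) := K₂ (1, x) hx₂
        exact hK.trans (H.apply_one _)
  obtain ⟨y, hy⟩ := nullhomotopic_of_interval u p.toContinuousMap
  exact ⟨y, hhom.trans hy⟩

end LowDim

section FillThree

variable {A : Type*} [NormedRing A] [NormedAlgebra ℝ A] [CompleteSpace A] [FiniteDimensional ℝ A]
  {G : Type*} [Group G] [TopologicalSpace G] [CompactSpace G]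
  {ρ : G →* A} (hρ : Continuous ρ)

theorem IsReg.inv {g : G} (h : IsReg hρ g⁻¹) : IsReg hρ g := by
  have key : ∀ x ∈ centA hρ g, x ∈ centA hρ g⁻¹ := by
    intro x hx
    rw [mem_centA] at hx ⊢
    refine ⟨hx.1, ?_⟩
    calc ρ g⁻¹ * x = ρ g⁻¹ * (x * ρ g) * ρ g⁻¹ := by
          rw [mul_assoc, mul_assoc, map_mul_map_inv, mul_one]
      _ = x * ρ g⁻¹ := by rw [← hx.2, ← mul_assoc, map_inv_mul_map, one_mul]
  exact fun x hx y hy => h x (key x hx) y (key y hy)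

theorem exists_norm_lt_imp_mem (hρ : Continuous ρ) (hinj : Function.Injective ρ) {U : Set G}
    (hU : U ∈ 𝓝 (1 : G)) : ∃ η > 0, ∀ g, ‖ρ g - 1‖ < η → g ∈ U := by
  rw [(isClosedEmbedding_rep hρ hinj).nhds_eq_comap, map_one, Metric.nhds_basis_ball.comap ρ |>.mem_iff] at hU
  obtain ⟨η, hη, h⟩ := hU
  exact ⟨η, hη, fun g hg => h (by simpa [dist_eq_norm] using hg)⟩

theorem exists_lipschitz_approx (hρ : Continuous ρ) (hinj : Function.Injective ρ) {κ : ℕ}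
    (f : C(bd κ, G)) {η : ℝ} (hη : 0 < η) :
    ∃ φ : (Fin κ → ℝ) → G, (∀ x : bd κ, ‖ρ (φ x) - ρ (f x)‖ < η) ∧
      ∀ x ∈ bd κ, ∃ K, ∃ t ∈ 𝓝 x, LipschitzOnWith K (fun x => ρ (φ x)) t := by
  obtain ⟨r, δ, C, hδ, hr⟩ := exists_retraction hρ hinj
  obtain ⟨F₀, hF₀⟩ := ContinuousMap.exists_restrict_eq (Y := A) (isClosed_bd κ)
    ⟨fun x => ρ (f x), by fun_prop⟩
  have hF₀' : ∀ x : bd κ, F₀ x = ρ (f x) := fun x => congrArg (fun g => g x) hF₀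
  set ε := min δ (η / (C + 1)) with hε
  have hε0 : 0 < ε := lt_min hδ (by positivity)
  obtain ⟨F, hF, hFd, -⟩ := F₀.continuous.exists_contDiff_approx 1
    (continuous_const (y := ε)) fun _ => hε0
  have hball : ∀ x : bd κ, F x ∈ Metric.ball (ρ (f x)) δ := fun x => by
    have := hFd x
    rw [hF₀'] at this
    exact this.trans_le (min_le_left _ _)
  refine ⟨fun x => r (F x), fun x => ?_, fun x hx => ?_⟩
  · have h1 := (hr (f x)).2.dist_le_mul _ (hball x) _ (Metric.mem_ball_self hδ)
    simp only [(hr (f x)).1, dist_eq_norm] at h1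
    have h2 : ‖F x - ρ (f x)‖ < η / (C + 1) := by
      have := hFd x
      rw [hF₀', dist_eq_norm] at this
      exact this.trans_le (min_le_right _ _)
    rw [lt_div_iff₀ (by positivity)] at h2
    have := norm_nonneg (F x - ρ (f x))
    nlinarith [C.2]
  · obtain ⟨K, t, ht, hK⟩ := hF.locallyLipschitz x
    refine ⟨C * K, t ∩ F ⁻¹' Metric.ball (ρ (f ⟨x, hx⟩)) δ, inter_mem ht
      (hF.continuous.continuousAt (Metric.isOpen_ball.mem_nhds (hball ⟨x, hx⟩))), ?_⟩
    exact (hr (f ⟨x, hx⟩)).2.comp (hK.mono inter_subset_left) fun y hy => hy.2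

/-- Affine parametrization of the `i`-th face of the tetrahedron. -/
def faceMap (i : Fin 4) (u : Fin 2 → ℝ) : Fin 4 → ℝ :=
  i.insertNth 0 ![u 0, u 1, 1 - u 0 - u 1]

theorem contDiff_faceMap (i : Fin 4) : ContDiff ℝ 1 (faceMap i) := by
  rw [contDiff_pi]
  intro j
  rcases Fin.eq_self_or_eq_succAbove i j with rfl | ⟨k, rfl⟩
  · simpa [faceMap] using contDiff_const
  · simp only [faceMap, Fin.insertNth_apply_succAbove]
    fin_cases k <;> simp <;> fun_prop

theorem exists_faceMap_eq {x : Fin 4 → ℝ} (hx : x ∈ bd 4) : ∃ i u, faceMap i u = x := by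
  obtain ⟨⟨-, hs⟩, i, hi⟩ := hx
  refine ⟨i, ![x (i.succAbove 0), x (i.succAbove 1)], ?_⟩
  rw [Fin.sum_univ_succAbove _ i, hi, zero_add, Fin.sum_univ_three] at hs
  ext j
  rcases Fin.eq_self_or_eq_succAbove i j with rfl | ⟨k, rfl⟩
  · simp [faceMap, hi]
  · simp only [faceMap, Fin.insertNth_apply_succAbove]
    fin_cases k
    · rfl
    · rfl
    · simp only [Matrix.cons_val_zero, Matrix.cons_val_one]
      change 1 - x (i.succAbove 0) - x (i.succAbove 1) = x (i.succAbove 2)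
      linarith

theorem exists_regular_translate [IsTopologicalGroup G] (hinj : Function.Injective ρ)
    {E : C(lieSub hρ, G)} (hE : ∀ X, ρ (E X) = exp (X : A)) {φ : (Fin 4 → ℝ) → G}
    (hφ : ∀ x ∈ bd 4, ∃ K, ∃ t ∈ 𝓝 x, LipschitzOnWith K (fun x => ρ (φ x)) t)
    {U : Set (lieSub hρ)} (hU : U ∈ 𝓝 0) :
    ∃ X ∈ U, ∀ x ∈ bd 4, IsReg hρ ((E X)⁻¹ * φ x) := by
  by_cases hne : ∃ s, ¬ IsReg hρ s
  swap
  · push Not at hne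
    exact ⟨0, mem_of_mem_nhds hU, fun _ _ => hne _⟩
  have hψ : ∀ i, ∀ u ∈ {u | faceMap i u ∈ bd 4}, ∃ C, ∃ t ∈ 𝓝[{u | faceMap i u ∈ bd 4}] u,
      LipschitzOnWith C (fun u => ρ (φ (faceMap i u))) t := by
    intro i u hu
    obtain ⟨K, t, ht, hK⟩ := hφ _ hu
    obtain ⟨K', t', ht', hK'⟩ := (contDiff_faceMap i).locallyLipschitz u
    exact ⟨K * K', t' ∩ faceMap i ⁻¹' t, mem_nhdsWithin_of_mem_nhds (inter_mem ht'
      ((contDiff_faceMap i).continuous.continuousAt ht)),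
      hK.comp (hK'.mono inter_subset_left) fun y hy => hy.2⟩
  obtain ⟨X, hXU, hX⟩ := exists_avoid hρ hinj _ _ hψ hne hU
  refine ⟨X, hXU, fun x hx => ?_⟩
  obtain ⟨i, u, rfl⟩ := exists_faceMap_eq hx
  by_contra hs
  refine hX i u hx _ (fun h => hs (IsReg.inv hρ h)) ?_
  rw [← hE, ← map_mul]
  simp

theorem isPreconnected_triangle :
    IsPreconnected {x : Fin 4 → ℝ | x ∈ stdSimplex ℝ (Fin 4) ∧ x 0 = 0 ∧ ∃ i, i ≠ 0 ∧ x i = 0} := by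
  let S : Fin 4 → Set (Fin 4 → ℝ) := fun i => {x | x ∈ stdSimplex ℝ (Fin 4) ∧ x 0 = 0 ∧ x i = 0}
  have hS : ∀ i, IsPreconnected (S i) := by
    intro i
    have h : Convex ℝ {x : Fin 4 → ℝ | x 0 = 0 ∧ x i = 0} := ?_
    · exact ((convex_stdSimplex ℝ (Fin 4)).inter h).isPreconnected
    intro x hx y hy a b _ _ _
    exact ⟨by simp [hx.1, hy.1], by simp [hx.2, hy.2]⟩
  have hs : ∀ i j : Fin 4, j ≠ 0 → j ≠ i → Pi.single j (1 : ℝ) ∈ S i := fun i j h0 hi =>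
    ⟨single_mem_stdSimplex ℝ j, by simp [h0.symm], by simp [hi.symm]⟩
  have h := (IsPreconnected.union (Pi.single 3 (1 : ℝ)) (hs 1 3 (by decide) (by decide))
    (hs 2 3 (by decide) (by decide)) (hS 1) (hS 2)).union (Pi.single 1 (1 : ℝ))
    (Or.inr (hs 2 1 (by decide) (by decide))) (hs 3 1 (by decide) (by decide)) (hS 3)
  convert h using 1
  ext x
  constructor
  · rintro ⟨h1, h2, i, hi, h3⟩
    fin_cases i
    · exact (hi rfl).elim
    · exact Or.inl (Or.inl ⟨h1, h2, h3⟩)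
    · exact Or.inl (Or.inr ⟨h1, h2, h3⟩)
    · exact Or.inr ⟨h1, h2, h3⟩
  · rintro ((h | h) | h)
    · exact ⟨h.1, h.2.1, 1, by decide, h.2.2⟩
    · exact ⟨h.1, h.2.1, 2, by decide, h.2.2⟩
    · exact ⟨h.1, h.2.1, 3, by decide, h.2.2⟩

theorem nullhomotopic_bd_four_of_base [IsTopologicalGroup G] (hρ : Continuous ρ)
    (hinj : Function.Injective ρ) (f : C(bd 4, G))
    (hf : f ⟨_, single_mem_bd (i := 1) (j := 0) (by decide)⟩ = 1) : f.Nullhomotopic := by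
  obtain ⟨E, hE⟩ := exists_expMap hρ hinj
  have hE0 : E 0 = 1 := hinj (by rw [hE, map_one]; simp)
  obtain ⟨M, hM0, hM⟩ := exists_norm_le_rep hρ
  obtain ⟨U₁, hU₁o, hU₁, hnull⟩ := exists_nullhomotopic_of_small.{0} hρ hinj
  obtain ⟨U₂, hU₂o, hU₂, hlog⟩ := exists_log_of_small.{0} hρ
  obtain ⟨W, hWo, hW1, hWW⟩ : ∃ W : Set G, IsOpen W ∧ (1 : G) ∈ W ∧
      ∀ a ∈ W, ∀ b ∈ W, a * b ∈ U₂ := by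
    obtain ⟨W, hW, h1, hWW⟩ := exists_open_nhds_one_mul_subset (hU₂o.mem_nhds hU₂)
    exact ⟨W, hW, h1, fun a ha b hb => hWW (mul_mem_mul ha hb)⟩
  obtain ⟨η₁, hη₁, h₁⟩ := exists_norm_lt_imp_mem hρ hinj (hU₁o.mem_nhds hU₁)
  obtain ⟨η₂, hη₂, h₂⟩ := exists_norm_lt_imp_mem hρ hinj (hWo.mem_nhds hW1)
  obtain ⟨φ, hφf, hφ⟩ := exists_lipschitz_approx hρ hinj f (lt_min (div_pos hη₁ hM0) hη₂)
  have hφc : ContinuousOn φ (bd 4) := by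
    intro x hx
    obtain ⟨K, t, ht, hK⟩ := hφ x hx
    refine ContinuousAt.continuousWithinAt ?_
    exact (isClosedEmbedding_rep hρ hinj).isInducing.continuousAt_iff.2
      (hK.continuousOn.continuousAt ht)
  obtain ⟨X, hX, hreg⟩ := exists_regular_translate hρ hinj hE hφ
    (U := {X | (E X)⁻¹ ∈ W}) ((E.continuous.inv).continuousAt.preimage_mem_nhds
      (hWo.mem_nhds (by simpa [hE0] using hW1)))
  let f' : C(bd 4, G) := ⟨fun x => φ x, continuousOn_iff_continuous_domRestrict.1 hφc⟩
  have hff' : (f * f'⁻¹).Nullhomotopic := by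
    refine hnull _ _ fun x => h₁ _ ?_
    have e : ρ ((f * f'⁻¹) x) - 1 = (ρ (f x) - ρ (φ x)) * ρ (φ x)⁻¹ := by
      rw [sub_mul, map_mul_map_inv, ← map_mul]
      rfl
    rw [e]
    calc _ ≤ ‖ρ (f x) - ρ (φ x)‖ * ‖ρ (φ x)⁻¹‖ := norm_mul_le _ _
      _ ≤ ‖ρ (f x) - ρ (φ x)‖ * M := by gcongr; exact hM _
      _ < η₁ := by
        rw [← lt_div_iff₀ hM0, norm_sub_rev]
        exact (hφf x).trans_le (min_le_left _ _)
  let e₁ : bd 4 := ⟨_, single_mem_bd (i := 1) (j := 0) (by decide)⟩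
  let R : Set G := {g | IsReg hρ g}
  let g : C(bd 4, R) := ⟨fun x => ⟨(E X)⁻¹ * φ x, hreg x x.2⟩,
    (continuous_const.mul f'.continuous).subtype_mk _⟩
  obtain ⟨X₁, hX₁⟩ : ∃ X₁, E X₁ = (E X)⁻¹ * φ e₁ := by
    obtain ⟨Y, hY⟩ := hlog Unit ⟨fun _ => (E X)⁻¹ * φ e₁, continuous_const⟩ fun _ =>
      hWW _ hX _ (h₂ _ (by
        have := (hφf e₁).trans_le (min_le_right _ _)
        rwa [show f e₁ = 1 from hf, map_one] at this))
    exact ⟨Y (), hinj (by rw [hE]; exact hY ())⟩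
  have cov := (isCoveringMapOn_expMap hρ hinj hE).isCoveringMap_restrictPreimage
  let D₁ : Set (Fin 4 → ℝ) := {x | x ∈ stdSimplex ℝ (Fin 4) ∧ x 0 = 0}
  let D₂ : Set (Fin 4 → ℝ) := {x | x ∈ stdSimplex ℝ (Fin 4) ∧ ∃ i, i ≠ 0 ∧ x i = 0}
  have hB : bd 4 = D₁ ∪ D₂ := by
    ext x
    constructor
    · rintro ⟨hx, i, hi⟩
      by_cases h : i = 0
      · exact Or.inl ⟨hx, h ▸ hi⟩
      · exact Or.inr ⟨hx, i, h, hi⟩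
    · rintro (⟨hx, h⟩ | ⟨hx, i, -, hi⟩)
      · exact ⟨hx, 0, h⟩
      · exact ⟨hx, i, hi⟩
  have hD₁c : IsClosed D₁ := (isClosed_stdSimplex (𝕜 := ℝ) (Fin 4)).inter
    (isClosed_eq (continuous_apply 0) continuous_const)
  have hD₂c : IsClosed D₂ := by
    have : D₂ = stdSimplex ℝ (Fin 4) ∩ ⋃ i, {x | i ≠ 0 ∧ x i = 0} := by ext x; simp [D₂]
    rw [this]
    refine (isClosed_stdSimplex (𝕜 := ℝ) (Fin 4)).inter (isClosed_iUnion_of_finite fun i => ?_)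
    exact isClosed_const.inter (isClosed_eq (continuous_apply i) continuous_const)
  have hs₁ : StarConvex ℝ (Pi.single 1 (1 : ℝ)) D₁ := by
    rintro y ⟨hy, hy0⟩ a b ha hb hab
    exact ⟨convex_stdSimplex ℝ (Fin 4) (single_mem_stdSimplex ℝ 1) hy ha hb hab, by simp [hy0]⟩
  have hs₂ : StarConvex ℝ (Pi.single 0 (1 : ℝ)) D₂ := by
    rintro y ⟨hy, i, hi, hyi⟩ a b ha hb hab
    exact ⟨convex_stdSimplex ℝ (Fin 4) (single_mem_stdSimplex ℝ 0) hy ha hb hab, i, hi,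
      by simp [hyi, hi]⟩
  have hc : IsPreconnected (D₁ ∩ D₂) := by
    convert isPreconnected_triangle using 1
    ext x
    constructor
    · rintro ⟨⟨h, h0⟩, -, h'⟩
      exact ⟨h, h0, h'⟩
    · rintro ⟨h, h0, h'⟩
      exact ⟨⟨h, h0⟩, h, h'⟩
  obtain ⟨L, hL⟩ := exists_lift_of_union cov hB hD₁c hD₂c
    (b₁ := Pi.single 1 1) (b₂ := Pi.single 0 1) (b := Pi.single 1 1)
    ⟨single_mem_stdSimplex ℝ 1, by simp⟩ ⟨single_mem_stdSimplex ℝ 0, 1, by simp, by simp⟩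
    hs₁ hs₂ hc ⟨⟨single_mem_stdSimplex ℝ 1, by simp⟩, single_mem_stdSimplex ℝ 1, 2, by simp, by simp⟩
    g (e := ⟨X₁, by rw [mem_preimage, hX₁]; exact hreg _ e₁.2⟩) (Subtype.ext hX₁)
  let g' : C(bd 4, G) := ⟨fun x => g x, by fun_prop⟩
  have hg' : g'.Nullhomotopic := by
    refine nullhomotopic_of_exp hρ hinj g' ⟨fun x => (L x : lieSub hρ), by fun_prop⟩ fun x => ?_
    have := congrArg Subtype.val (congrFun hL x)
    rw [← hE]
    exact congrArg ρ this
  have hconst : (ContinuousMap.const (bd 4) (E X)).Nullhomotopic := ⟨_, ContinuousMap.Homotopic.refl _⟩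
  have e : f = f * f'⁻¹ * (ContinuousMap.const (bd 4) (E X) * g') := by
    ext x
    change f x = f x * (φ x)⁻¹ * (E X * ((E X)⁻¹ * φ x))
    group
  rw [e]
  exact nullhomotopic_mul hff' (nullhomotopic_mul hconst hg')

/-- Every map from a 2-sphere to a compact linear group is null-homotopic. -/
theorem nullhomotopic_bd_four [IsTopologicalGroup G] (hρ : Continuous ρ)
    (hinj : Function.Injective ρ) (f : C(bd 4, G)) : f.Nullhomotopic := by
  let y := f ⟨_, single_mem_bd (i := 1) (j := 0) (by decide)⟩
  have h := nullhomotopic_bd_four_of_base hρ hinj (ContinuousMap.const _ y⁻¹ * f) (by simp [y])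
  have hconst : (ContinuousMap.const (bd 4) y).Nullhomotopic := ⟨_, ContinuousMap.Homotopic.refl _⟩
  have e : f = ContinuousMap.const _ y * (ContinuousMap.const _ y⁻¹ * f) := by
    ext x
    simp
  rw [e]
  exact nullhomotopic_mul hconst h

end FillThree

section Complex

variable {A : Type*} [NormedRing A] [NormedAlgebra ℝ A] [CompleteSpace A] [FiniteDimensional ℝ A]
  {G : Type*} [Group G] [TopologicalSpace G] [CompactSpace G]
  {ρ : G →* A}

theorem nullhomotopic_bd [IsTopologicalGroup G] [SimplyConnectedSpace G] (hρ : Continuous ρ)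
    (hinj : Function.Injective ρ) {κ : ℕ} (hκ : κ ≤ 4) (f : C(bd κ, G)) : f.Nullhomotopic := by
  interval_cases κ
  · have hE : IsEmpty (bd 0) := ⟨fun x => by simpa using x.2.1.2⟩
    exact ⟨1, by rw [show f = ContinuousMap.const _ 1 from ContinuousMap.ext fun x => hE.elim x]⟩
  · exact nullhomotopic_bd_one f
  · exact nullhomotopic_bd_two f
  · exact nullhomotopic_bd_three f
  · exact nullhomotopic_bd_four hρ hinj f

variable {ι : Type*} [Fintype ι]

/-- The closed face of the standard simplex spanned by `σ`. -/
def face (σ : Finset ι) : Set (ι → ℝ) := {x | x ∈ stdSimplex ℝ ι ∧ ∀ i ∉ σ, x i = 0}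

/-- The boundary of the face spanned by `σ`. -/
def bdFace (σ : Finset ι) : Set (ι → ℝ) := {x | x ∈ face σ ∧ ∃ i ∈ σ, x i = 0}

/-- The geometric realization of a finite family of simplices. -/
def geo (S : Finset (Finset ι)) : Set (ι → ℝ) := ⋃ σ ∈ S, face σ

theorem isCompact_face (σ : Finset ι) : IsCompact (face σ) := by
  have : face σ = stdSimplex ℝ ι ∩ ⋂ i, {x | i ∉ σ → x i = 0} := by ext x; simp [face]
  rw [this]
  refine (isCompact_stdSimplex ℝ ι).inter_right (isClosed_iInter fun i => ?_)
  by_cases h : i ∈ σ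
  · simp [h]
  · simpa [h] using isClosed_eq (continuous_apply i) continuous_const

theorem isClosed_bdFace (σ : Finset ι) : IsClosed (bdFace σ) := by
  have : bdFace σ = face σ ∩ ⋃ i ∈ σ, {x | x i = 0} := by ext x; simp [bdFace]
  rw [this]
  exact (isCompact_face σ).isClosed.inter (isClosed_biUnion_finset fun i _ =>
    isClosed_eq (continuous_apply i) continuous_const)

theorem isClosed_geo (S : Finset (Finset ι)) : IsClosed (geo S) :=
  isClosed_biUnion_finset fun σ _ => (isCompact_face σ).isClosed

theorem nullhomotopic_bdFace [IsTopologicalGroup G] [SimplyConnectedSpace G] (hρ : Continuous ρ)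
    (hinj : Function.Injective ρ) {σ : Finset ι} (hσ : σ.card ≤ 4) (f : C(bdFace σ, G)) :
    f.Nullhomotopic := by
  classical
  have e : σ ≃ Fin σ.card := σ.equivFin
  have hsum : ∀ x : ι → ℝ, (∀ i ∉ σ, x i = 0) → ∑ i, x i = ∑ k, x (e.symm k) := by
    intro x hx
    rw [e.symm.sum_comp (fun i : σ => x i), Finset.sum_coe_sort σ x]
    exact (Finset.sum_subset (Finset.subset_univ σ) fun i _ hi => hx i hi).symm
  let j : C(bd σ.card, bdFace σ) := ⟨fun x => ⟨fun i => if h : i ∈ σ then x.1 (e ⟨i, h⟩) else 0, by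
      refine ⟨⟨⟨fun i => ?_, ?_⟩, fun i hi => dif_neg hi⟩, ?_⟩
      · by_cases h : i ∈ σ
        · simpa [h] using x.2.1.1 _
        · simp [h]
      · rw [hsum _ fun i hi => dif_neg hi, ← x.2.1.2]
        simp
      · obtain ⟨k, hk⟩ := x.2.2
        exact ⟨e.symm k, (e.symm k).2, by simpa using hk⟩⟩, by
    refine continuous_induced_rng.2 (continuous_pi fun i => ?_)
    by_cases h : i ∈ σ
    · simpa [h] using continuous_coord _
    · simpa [h] using continuous_const⟩
  let j' : C(bdFace σ, bd σ.card) := ⟨fun y => ⟨fun k => y.1 (e.symm k), by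
      refine ⟨⟨fun k => y.2.1.1.1 _, ?_⟩, ?_⟩
      · rw [← y.2.1.1.2, hsum _ y.2.1.2]
      · obtain ⟨i, hi, h0⟩ := y.2.2
        exact ⟨e ⟨i, hi⟩, by simpa using h0⟩⟩, by
    refine continuous_induced_rng.2 (continuous_pi fun k => ?_)
    exact (continuous_apply (e.symm k : ι)).comp (continuous_subtype_val (p := (· ∈ bdFace σ)))⟩
  have hjj : j.comp j' = ContinuousMap.id _ := by
    ext y i
    by_cases h : i ∈ σ
    · simp [j, j', h]
    · simp [j, j', h, y.2.1.2 i h]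
  have h := (nullhomotopic_bd hρ hinj hσ (f.comp j)).comp_left j'
  rwa [ContinuousMap.comp_assoc, hjj, ContinuousMap.comp_id] at h

theorem exists_extension_face [IsTopologicalGroup G] [SimplyConnectedSpace G] (hρ : Continuous ρ)
    (hinj : Function.Injective ρ) {σ : Finset ι} (hσ : σ.card ≤ 4) (f : C(bdFace σ, G)) :
    ∃ F : C(face σ, G), ∀ x (hx : x ∈ bdFace σ), F ⟨x, hx.1⟩ = f ⟨x, hx⟩ := by
  have : CompactSpace (face σ) := isCompact_iff_compactSpace.1 (isCompact_face σ)
  let B : Set (face σ) := Subtype.val ⁻¹' bdFace σ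
  let j : C(B, bdFace σ) := ⟨fun x => ⟨x.1.1, x.2⟩, by fun_prop⟩
  obtain ⟨F, hF⟩ := exists_extension_of_nullhomotopic hρ hinj
    ((isClosed_bdFace σ).preimage continuous_subtype_val : IsClosed B) (f.comp j)
    ((nullhomotopic_bdFace hρ hinj hσ f).comp_left j)
  exact ⟨F, fun x hx => hF ⟨⟨x, hx.1⟩, hx⟩⟩

theorem exists_extension_geo [DecidableEq ι] [IsTopologicalGroup G] [SimplyConnectedSpace G]
    (hρ : Continuous ρ)
    (hinj : Function.Injective ρ) {S₀ : Finset (Finset ι)} (h₀ : IsLowerSet (S₀ : Set (Finset ι)))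
    (f : C(geo S₀, G)) : ∀ (n : ℕ) (S : Finset (Finset ι)), (S \ S₀).card = n → S₀ ⊆ S →
      IsLowerSet (S : Set (Finset ι)) → (∀ σ ∈ S, σ.card ≤ 4) →
      ∃ F : C(geo S, G), ∀ x hx hx', F ⟨x, hx⟩ = f ⟨x, hx'⟩ := by
  intro n
  induction n with
  | zero =>
    intro S hS hS₀ _ _
    have : S = S₀ := by
      rw [Finset.card_eq_zero, Finset.sdiff_eq_empty_iff_subset] at hS
      exact hS.antisymm hS₀
    subst this
    exact ⟨f, fun _ _ _ => rfl⟩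
  | succ n ih =>
    intro S hS hS₀ hlow hcard
    obtain ⟨σ, hσ⟩ := (S \ S₀).exists_maximal (Finset.card_pos.1 (by omega))
    have hσS := (Finset.mem_sdiff.1 hσ.prop).1
    have hσS₀ := (Finset.mem_sdiff.1 hσ.prop).2
    have hmax : ∀ τ ∈ S, σ ⊆ τ → τ = σ := by
      intro τ hτ hστ
      have hτ₀ : τ ∉ S₀ := fun h => hσS₀ (h₀ hστ h)
      exact (hσ.le_of_ge (Finset.mem_sdiff.2 ⟨hτ, hτ₀⟩) hστ).antisymm hστ
    obtain ⟨F', hF'⟩ := ih (S.erase σ)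
      (by
        rw [Finset.erase_sdiff_comm, Finset.card_erase_of_mem hσ.prop, hS]
        rfl)
      (fun τ hτ => Finset.mem_erase.2 ⟨fun h => hσS₀ (h ▸ hτ), hS₀ hτ⟩)
      (by
        intro τ τ' hτ' hτ
        have hτ := Finset.mem_erase.1 hτ
        refine Finset.mem_erase.2 ⟨?_, hlow hτ' hτ.2⟩
        rintro rfl
        exact hτ.1 (hmax τ hτ.2 hτ'))
      (fun τ hτ => hcard τ (Finset.mem_of_mem_erase hτ))
    have hsub : bdFace σ ⊆ geo (S.erase σ) := by
      rintro x ⟨hx, i, hi, h0⟩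
      refine mem_iUnion₂.2 ⟨σ.erase i, Finset.mem_erase.2 ⟨fun h => ?_, hlow (σ.erase_subset i) hσS⟩,
        hx.1, fun k hk => ?_⟩
      · exact (Finset.erase_eq_self.1 h) hi
      · by_cases hki : k = i
        · rwa [hki]
        · exact hx.2 k fun h => hk (Finset.mem_erase.2 ⟨hki, h⟩)
    have hinter : ∀ x ∈ geo (S.erase σ), x ∈ face σ → x ∈ bdFace σ := by
      intro x hx hxσ
      obtain ⟨τ, hτ, hxτ⟩ := mem_iUnion₂.1 hx
      have hτ := Finset.mem_erase.1 hτ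
      have : ¬ σ ⊆ τ := fun h => hτ.1 (hmax τ hτ.2 h)
      obtain ⟨i, hi, hiτ⟩ := Finset.not_subset.1 this
      exact ⟨hxσ, i, hi, hxτ.2 i hiτ⟩
    obtain ⟨Φ, hΦ⟩ := exists_extension_face hρ hinj (hcard σ hσS)
      ⟨fun x : bdFace σ => F' ⟨x, hsub x.2⟩, by fun_prop⟩
    let D₁ : Set (geo S) := Subtype.val ⁻¹' geo (S.erase σ)
    let D₂ : Set (geo S) := Subtype.val ⁻¹' face σ
    let F₁ : C(D₁, G) := ⟨fun x => F' ⟨x.1.1, x.2⟩, by fun_prop⟩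
    let F₂ : C(D₂, G) := ⟨fun x => Φ ⟨x.1.1, x.2⟩, by fun_prop⟩
    obtain ⟨F, hF₁, -⟩ := exists_glue (D₁ := D₁) (D₂ := D₂)
      ((isClosed_geo _).preimage continuous_subtype_val)
      ((isCompact_face σ).isClosed.preimage continuous_subtype_val)
      (by
        refine eq_univ_of_forall fun x => ?_
        obtain ⟨τ, hτ, hxτ⟩ := mem_iUnion₂.1 x.2
        by_cases h : τ = σ
        · subst h
          exact Or.inr hxτ
        · exact Or.inl (mem_iUnion₂.2 ⟨τ, Finset.mem_erase.2 ⟨h, hτ⟩, hxτ⟩))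
      F₁ F₂ (fun x hx hx' => (hΦ x.1 (hinter _ hx hx')).symm)
    refine ⟨F, fun x hx hx' => ?_⟩
    have hx₁ : x ∈ geo (S.erase σ) := by
      obtain ⟨τ, hτ, hxτ⟩ := mem_iUnion₂.1 hx'
      exact mem_iUnion₂.2 ⟨τ, Finset.mem_erase.2 ⟨fun h => hσS₀ (h ▸ hτ), hS₀ hτ⟩, hxτ⟩
    exact (hF₁ ⟨x, hx⟩ hx₁).trans (hF' x hx₁ hx')

end Complex

section Nerve

universe w

variable {Z : Type w} [TopologicalSpace Z] [CompactSpace Z] [T2Space Z]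

/-- A fine cover of order at most `n + 1` on whose members a given map is almost constant. -/
theorem exists_fine_cover {A : Type*} [PseudoMetricSpace A] {n : ℕ} (hZ : CovDimLE Z n) {Z₀ : Set Z}
    (hZ₀ : IsClosed Z₀) (g : C(Z₀, A)) {ε : ℝ} (hε : 0 < ε) :
    ∃ 𝒱 : Finset (Set Z), (∀ V ∈ 𝒱, IsOpen V) ∧ ⋃₀ (𝒱 : Set (Set Z)) = univ ∧
      (∀ V ∈ 𝒱, ∀ z w : Z₀, (z : Z) ∈ V → (w : Z) ∈ V → dist (g z) (g w) < ε) ∧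
      ∀ z : Z, Nat.card {V : Set Z // V ∈ 𝒱 ∧ z ∈ V} ≤ n + 1 := by
  classical
  have hloc : ∀ z : Z, ∃ U : Set Z, IsOpen U ∧ z ∈ U ∧
      ∀ a b : Z₀, (a : Z) ∈ U → (b : Z) ∈ U → dist (g a) (g b) < ε := by
    intro z
    by_cases hz : z ∈ Z₀
    · have hO : IsOpen (g ⁻¹' Metric.ball (g ⟨z, hz⟩) (ε / 2)) :=
        Metric.isOpen_ball.preimage g.continuous
      obtain ⟨U, hU, hUe⟩ := isOpen_induced_iff.1 hO
      have hmem : ∀ a : Z₀, (a : Z) ∈ U → dist (g a) (g ⟨z, hz⟩) < ε / 2 := fun a ha => by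
        have : a ∈ Subtype.val ⁻¹' U := ha
        rw [hUe] at this
        exact this
      refine ⟨U, hU, ?_, fun a b ha hb => ?_⟩
      · change (⟨z, hz⟩ : Z₀) ∈ Subtype.val ⁻¹' U
        rw [hUe]
        exact Metric.mem_ball_self (half_pos hε)
      · have := dist_triangle_right (g a) (g b) (g ⟨z, hz⟩)
        linarith [hmem a ha, hmem b hb]
    · exact ⟨Z₀ᶜ, hZ₀.isOpen_compl, hz, fun a _ ha => (ha a.2).elim⟩
  choose U hUo hUm hU using hloc
  obtain ⟨t, ht⟩ := isCompact_univ.elim_finite_subcover U hUo fun z _ => mem_iUnion.2 ⟨z, hUm z⟩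
  obtain ⟨𝒱, hVo, hVc, hVU, hcard⟩ := hZ (t.image U) (by simpa using fun z _ => hUo z) (by
    refine eq_univ_of_forall fun z => ?_
    obtain ⟨i, hi, hz⟩ := mem_iUnion₂.1 (ht (mem_univ z))
    exact ⟨U i, by simpa using ⟨i, hi, rfl⟩, hz⟩)
  refine ⟨𝒱, hVo, hVc, fun V hV z w hz hw => ?_, hcard⟩
  obtain ⟨W, hW, hVW⟩ := hVU V hV
  obtain ⟨i, -, rfl⟩ := Finset.mem_image.1 hW
  exact hU i z w (hVW hz) (hVW hw)

variable {A : Type*} [NormedRing A] [NormedAlgebra ℝ A] [CompleteSpace A] [FiniteDimensional ℝ A]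
  {G : Type*} [Group G] [TopologicalSpace G] [CompactSpace G]
  {ρ : G →* A}

/-- Approximate extension. -/
theorem exists_approx_extension [IsTopologicalGroup G] [SimplyConnectedSpace G] (hρ : Continuous ρ)
    (hinj : Function.Injective ρ) (hZ : CovDimLE Z 3) {Z₀ : Set Z} (hZ₀ : IsClosed Z₀)
    (g : C(Z₀, G)) {η : ℝ} (hη : 0 < η) :
    ∃ f : C(Z, G), ∀ z : Z₀, ‖ρ (f z) - ρ (g z)‖ < η := by
  classical
  obtain ⟨r, δ, C, hδ, hr⟩ := exists_retraction hρ hinj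
  set ε := min (δ / 2) (η / (C + 1)) with hεdef
  have hε : 0 < ε := lt_min (half_pos hδ) (by positivity)
  obtain ⟨𝒱, hVo, hVc, hVg, hcard⟩ := exists_fine_cover hZ hZ₀
    (⟨fun z => ρ (g z), by fun_prop⟩ : C(Z₀, A)) hε
  let ι := {V : Set Z // V ∈ 𝒱}
  obtain ⟨p, hp⟩ := PartitionOfUnity.exists_isSubordinate (ι := ι) (s := univ) isClosed_univ
    (fun i => (i : Set Z)) (fun i => hVo i i.2) (by
      intro z _
      obtain ⟨V, hV, hz⟩ : z ∈ ⋃₀ (𝒱 : Set (Set Z)) := hVc ▸ mem_univ z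
      exact mem_iUnion.2 ⟨⟨V, hV⟩, hz⟩)
  have hpV : ∀ i z, p i z ≠ 0 → z ∈ (i : Set Z) := fun i z h =>
    hp i (subset_tsupport _ h)
  have hps : ∀ z, ∑ i, p i z = 1 := fun z => by
    rw [← finsum_eq_sum_of_fintype]
    exact p.sum_eq_one (mem_univ z)
  let P : C(Z, ι → ℝ) := ⟨fun z i => p i z, by fun_prop⟩
  have hP : ∀ z, P z ∈ stdSimplex ℝ ι := fun z => ⟨fun i => p.nonneg i z, hps z⟩
  let S : Finset (Finset ι) := Finset.univ.filter fun σ => ∃ z, ∀ i ∈ σ, z ∈ (i : Set Z)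
  let S₀ : Finset (Finset ι) := Finset.univ.filter fun σ => ∃ z ∈ Z₀, ∀ i ∈ σ, z ∈ (i : Set Z)
  have hS : ∀ σ, σ ∈ S ↔ ∃ z, ∀ i ∈ σ, z ∈ (i : Set Z) := fun σ => by simp [S]
  have hS₀ : ∀ σ, σ ∈ S₀ ↔ ∃ z ∈ Z₀, ∀ i ∈ σ, z ∈ (i : Set Z) := fun σ => by simp [S₀]
  have hlow : IsLowerSet (S : Set (Finset ι)) := by
    intro τ σ hστ hτ
    obtain ⟨z, hz⟩ := (hS τ).1 hτ
    exact (hS σ).2 ⟨z, fun i hi => hz i (hστ hi)⟩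
  have hlow₀ : IsLowerSet (S₀ : Set (Finset ι)) := by
    intro τ σ hστ hτ
    obtain ⟨z, hz₀, hz⟩ := (hS₀ τ).1 hτ
    exact (hS₀ σ).2 ⟨z, hz₀, fun i hi => hz i (hστ hi)⟩
  have hsub : S₀ ⊆ S := by
    intro σ hσ
    obtain ⟨z, -, hz⟩ := (hS₀ σ).1 hσ
    exact (hS σ).2 ⟨z, hz⟩
  have hSc : ∀ σ ∈ S, σ.card ≤ 4 := by
    intro σ hσ
    obtain ⟨z, hz⟩ := (hS σ).1 hσ
    refine le_trans ?_ (hcard z)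
    rw [← Nat.card_eq_finsetCard σ]
    have : Finite {V : Set Z // V ∈ 𝒱 ∧ z ∈ V} :=
      (𝒱.finite_toSet.subset fun V hV => hV.1 : {V : Set Z | V ∈ 𝒱 ∧ z ∈ V}.Finite).to_subtype
    exact Nat.card_le_card_of_injective
      (fun i : σ => (⟨i.1, i.1.2, hz i.1 i.2⟩ : {V : Set Z // V ∈ 𝒱 ∧ z ∈ V}))
      fun i j hij => Subtype.ext (Subtype.ext (show (i.1.1 : Set Z) = j.1.1 from Subtype.mk.inj hij))
  let c : ι → A := fun i => if h : ∃ z : Z₀, (z : Z) ∈ (i : Set Z) then ρ (g h.choose) else 0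
  have hc : ∀ (i : ι) (z : Z₀), (z : Z) ∈ (i : Set Z) → ‖c i - ρ (g z)‖ ≤ ε := by
    intro i z hz
    have h : ∃ z : Z₀, (z : Z) ∈ (i : Set Z) := ⟨z, hz⟩
    have hci : c i = ρ (g h.choose) := dif_pos h
    rw [hci, ← dist_eq_norm]
    exact (hVg i i.2 _ _ h.choose_spec hz).le
  let a : (ι → ℝ) → A := fun x => ∑ i, x i • c i
  have ha : Continuous a := by fun_prop
  have hclose : ∀ x ∈ stdSimplex ℝ ι, ∀ z : Z₀, (∀ i, x i ≠ 0 → (z : Z) ∈ (i : Set Z)) →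
      ‖a x - ρ (g z)‖ ≤ ε := by
    intro x hx z hz
    have e : a x - ρ (g z) = ∑ i, x i • (c i - ρ (g z)) := by
      simp only [smul_sub, Finset.sum_sub_distrib, ← Finset.sum_smul, hx.2, one_smul, a]
    rw [e]
    calc _ ≤ ∑ i, ‖x i • (c i - ρ (g z))‖ := norm_sum_le _ _
      _ ≤ ∑ i, x i * ε := by
        refine Finset.sum_le_sum fun i _ => ?_
        rw [norm_smul, Real.norm_of_nonneg (hx.1 i)]
        by_cases h : x i = 0
        · simp [h]
        · exact mul_le_mul_of_nonneg_left (hc i z (hz i h)) (hx.1 i)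
      _ = ε := by rw [← Finset.sum_mul, hx.2, one_mul]
  have hball : ∀ x z, ‖a x - ρ (g z)‖ ≤ ε → a x ∈ Metric.ball (ρ (g z)) δ := by
    intro x z h
    rw [Metric.mem_ball, dist_eq_norm]
    exact h.trans_lt ((min_le_left _ _).trans_lt (half_lt_self hδ))
  have hgeo : ∀ x ∈ geo S₀, ∃ z : Z₀, ‖a x - ρ (g z)‖ ≤ ε := by
    intro x hx
    obtain ⟨σ, hσ, hxσ⟩ := mem_iUnion₂.1 hx
    obtain ⟨z, hz₀, hz⟩ := (hS₀ σ).1 hσ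
    refine ⟨⟨z, hz₀⟩, hclose x hxσ.1 _ fun i hi => hz i ?_⟩
    by_contra h
    exact hi (hxσ.2 i h)
  have hcont : Continuous fun x : geo S₀ => r (a x) := by
    rw [(isClosedEmbedding_rep hρ hinj).isInducing.continuous_iff, continuous_iff_continuousAt]
    intro x
    obtain ⟨z, hz⟩ := hgeo x x.2
    exact ContinuousAt.comp (f := fun x : geo S₀ => a x) (g := fun b => ρ (r b))
      ((hr (g z)).2.continuousOn.continuousAt (Metric.isOpen_ball.mem_nhds (hball x z hz)))
      (ha.comp continuous_subtype_val).continuousAt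
  obtain ⟨h, hh⟩ := exists_extension_geo hρ hinj hlow₀ ⟨_, hcont⟩ _ S rfl hsub hlow hSc
  let supp : Z → Finset ι := fun z => Finset.univ.filter fun i => p i z ≠ 0
  have hPface : ∀ z, P z ∈ face (supp z) := fun z => ⟨hP z, fun i hi =>
    show p i z = 0 by simpa [supp] using hi⟩
  have hPS : ∀ z, P z ∈ geo S := fun z => mem_iUnion₂.2 ⟨supp z, (hS _).2 ⟨z, fun i hi =>
    hpV i z (by simpa [supp] using hi)⟩, hPface z⟩
  have hPS₀ : ∀ z ∈ Z₀, P z ∈ geo S₀ := fun z hz => mem_iUnion₂.2 ⟨supp z, (hS₀ _).2 ⟨z, hz,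
    fun i hi => hpV i z (by simpa [supp] using hi)⟩, hPface z⟩
  refine ⟨⟨fun z => h ⟨P z, hPS z⟩, by fun_prop⟩, fun z => ?_⟩
  have e : h ⟨P z, hPS z⟩ = r (a (P z)) := hh _ _ (hPS₀ z z.2)
  change ‖ρ (h ⟨P z, hPS z⟩) - ρ (g z)‖ < η
  rw [e]
  have h1 := hclose (P z) (hP z) z fun i hi => hpV i z hi
  have h2 := (hr (g z)).2.dist_le_mul _ (hball _ _ h1) _ (Metric.mem_ball_self hδ)
  simp only [(hr (g z)).1, dist_eq_norm] at h2
  have h3 := h1.trans (min_le_right _ _)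
  rw [le_div_iff₀ (by positivity)] at h3
  have := norm_nonneg (a (P z) - ρ (g z))
  rcases this.eq_or_lt with h0 | h0
  · rw [← h0, mul_zero] at h2
    exact h2.trans_lt hη
  · nlinarith

/-- A simply connected compact linear group is an absolute extensor in dimension three. -/
theorem exists_extension_of_covDimLE [IsTopologicalGroup G] [SimplyConnectedSpace G]
    (hρ : Continuous ρ) (hinj : Function.Injective ρ) (hZ : CovDimLE Z 3) {Z₀ : Set Z}
    (hZ₀ : IsClosed Z₀) (g : C(Z₀, G)) : ∃ f : C(Z, G), ∀ z : Z₀, f z = g z := by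
  obtain ⟨M, hM0, hM⟩ := exists_norm_le_rep hρ
  obtain ⟨U, hUo, hU1, hU⟩ := exists_extension_of_small.{w} hρ hinj
  obtain ⟨η, hη, hηU⟩ := exists_norm_lt_imp_mem hρ hinj (hUo.mem_nhds hU1)
  obtain ⟨f, hf⟩ := exists_approx_extension hρ hinj hZ hZ₀ g (div_pos hη hM0)
  obtain ⟨k, hk⟩ := hU Z Z₀ hZ₀ ⟨fun z => (f z)⁻¹ * g z, by fun_prop⟩ fun z => hηU _ (by
    have e : ρ ((f z)⁻¹ * g z) - 1 = ρ (f z)⁻¹ * (ρ (g z) - ρ (f z)) := by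
      rw [mul_sub, map_inv_mul_map, map_mul]
    change ‖ρ ((f z)⁻¹ * g z) - 1‖ < η
    rw [e]
    calc _ ≤ ‖ρ (f z)⁻¹‖ * ‖ρ (g z) - ρ (f z)‖ := norm_mul_le _ _
      _ ≤ M * ‖ρ (g z) - ρ (f z)‖ := by gcongr; exact hM _
      _ < η := by
        rw [norm_sub_rev, mul_comm, ← lt_div_iff₀ hM0]
        exact hf z)
  refine ⟨f * k, fun z => ?_⟩
  rw [ContinuousMap.mul_apply, hk]
  exact mul_inv_cancel_left _ _

end Nerve

section KernelOperator

open MeasureTheory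
open scoped RealInnerProductSpace BoundedContinuousFunction

variable {X : Type*} [TopologicalSpace X] [CompactSpace X]

section Coeff

variable {H : Type*} [NormedAddCommGroup H] [InnerProductSpace ℝ H]

/-- The operator taking `f` to the function `x ↦ ⟪v x, f⟫`. -/
noncomputable def coeffMap (v : C(X, H)) : H →L[ℝ] (X →ᵇ ℝ) :=
  LinearMap.mkContinuous
    { toFun := fun f => BoundedContinuousFunction.mkOfCompact ⟨fun x => ⟪v x, f⟫, by fun_prop⟩
      map_add' := fun f g => by ext x; exact inner_add_right _ _ _
      map_smul' := fun c f => by ext x; exact real_inner_smul_right _ _ _ }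
    ‖v‖ fun f => by
      refine (BoundedContinuousFunction.norm_le (by positivity)).2 fun x => ?_
      exact (norm_inner_le_norm _ _).trans (by gcongr; exact v.norm_coe_le_norm x)

@[simp] theorem coeffMap_apply (v : C(X, H)) (f : H) (x : X) : coeffMap v f x = ⟪v x, f⟫ := rfl

theorem isCompactOperator_coeffMap (v : C(X, H)) : IsCompactOperator (coeffMap v) := by
  have h := (isCompactOperator_iff_isCompact_closure_image_closedBall
    (coeffMap v : H →ₗ[ℝ] (X →ᵇ ℝ)) zero_lt_one).2
  refine h (BoundedContinuousFunction.arzela_ascoli (Metric.closedBall 0 ‖v‖)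
    (isCompact_closedBall _ _) _ ?_ ?_)
  · rintro _ x ⟨f, hf, rfl⟩
    rw [mem_closedBall_zero_iff] at hf ⊢
    calc _ ≤ ‖v x‖ * ‖f‖ := norm_inner_le_norm _ _
      _ ≤ ‖v‖ * 1 := by gcongr; exact v.norm_coe_le_norm x
      _ = ‖v‖ := mul_one _
  · intro x
    rw [Metric.equicontinuousAt_iff_right]
    intro ε hε
    filter_upwards [v.continuous.continuousAt.eventually (Metric.ball_mem_nhds _ hε)] with y hy
    rintro ⟨_, f, hf, rfl⟩
    rw [mem_closedBall_zero_iff] at hf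
    change dist ⟪v x, f⟫ ⟪v y, f⟫ < ε
    rw [dist_comm, dist_eq_norm] at hy
    rw [Real.dist_eq, ← inner_sub_left]
    calc _ ≤ ‖v x - v y‖ * ‖f‖ := abs_real_inner_le_norm _ _
      _ ≤ ‖v x - v y‖ * 1 := by gcongr
      _ < ε := by rwa [mul_one]

end Coeff

variable [T2Space X] [MeasurableSpace X] [BorelSpace X] (μ : Measure X) [IsFiniteMeasure μ]

/-- The rows of a continuous kernel, as vectors in `L²`. -/
noncomputable def kernelRow (F : C(X × X, ℝ)) : C(X, Lp ℝ 2 μ) :=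
  ⟨fun x => ContinuousMap.toLp 2 μ ℝ (F.curry x),
    (ContinuousMap.toLp 2 μ ℝ).continuous.comp F.curry.continuous⟩

theorem kernelRow_apply (F : C(X × X, ℝ)) (x : X) :
    kernelRow μ F x = ContinuousMap.toLp 2 μ ℝ (F.curry x) := rfl

/-- The integral operator with a continuous kernel. -/
noncomputable def kernelOp (F : C(X × X, ℝ)) : Lp ℝ 2 μ →L[ℝ] Lp ℝ 2 μ :=
  (BoundedContinuousFunction.toLp 2 μ ℝ).comp (coeffMap (kernelRow μ F))

theorem isCompactOperator_kernelOp (F : C(X × X, ℝ)) : IsCompactOperator (kernelOp μ F) :=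
  (isCompactOperator_coeffMap (kernelRow μ F)).clm_comp (BoundedContinuousFunction.toLp 2 μ ℝ)

theorem isSymmetric_kernelOp [μ.WeaklyRegular] {F : C(X × X, ℝ)} (hF : ∀ x y, F (x, y) = F (y, x)) :
    (kernelOp μ F).IsSymmetric := by
  have hd := BoundedContinuousFunction.toLp_denseRange (E := ℝ) μ (p := 2) ℝ (by simp) (α := X)
  have key : ∀ a b : X →ᵇ ℝ, ⟪kernelOp μ F (BoundedContinuousFunction.toLp 2 μ ℝ a),
      BoundedContinuousFunction.toLp 2 μ ℝ b⟫ = ∫ x, ∫ y, b x * (a y * F (x, y)) ∂μ ∂μ := by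
    intro a b
    have h : ∀ x, coeffMap (kernelRow μ F) (BoundedContinuousFunction.toLp 2 μ ℝ a) x =
        ∫ y, a y * F (x, y) ∂μ := fun x =>
      BoundedContinuousFunction.inner_toLp μ
        (BoundedContinuousFunction.mkOfCompact (F.curry x)) a
    rw [kernelOp, ContinuousLinearMap.comp_apply, BoundedContinuousFunction.inner_toLp]
    refine integral_congr_ae (Eventually.of_forall fun x => ?_)
    simp only [h, conj_trivial, integral_const_mul]
  intro f g
  refine hd.induction_on₂ (p := fun f g => ⟪kernelOp μ F f, g⟫ = ⟪f, kernelOp μ F g⟫) ?_ ?_ f g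
  · exact isClosed_eq (by fun_prop) (by fun_prop)
  · intro a b
    rw [real_inner_comm (kernelOp μ F _), key, key, integral_integral_swap_of_hasCompactSupport
      (by simp only [Function.uncurry_def]; fun_prop) (HasCompactSupport.of_compactSpace _)]
    simp only [hF, mul_left_comm]

end KernelOperator

section Translation

open MeasureTheory DomMulAct Module
open scoped RealInnerProductSpace BoundedContinuousFunction

variable {G : Type*} [Group G] [TopologicalSpace G] [IsTopologicalGroup G] [CompactSpace G]
  [T2Space G] [MeasurableSpace G] [BorelSpace G] (μ : Measure G) [μ.IsHaarMeasure] [μ.Regular]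

/-- Translation `f ↦ (x ↦ f (g * x))` of square integrable functions. -/
noncomputable def translate (g : G) : Lp ℝ 2 μ →ₗᵢ[ℝ] Lp ℝ 2 μ where
  toFun f := mk g • f
  map_add' := smul_add _
  map_smul' _ _ := smul_comm _ _ _
  norm_map' := norm_smul_Lp _

theorem translate_one (f : Lp ℝ 2 μ) : translate μ 1 f = f :=
  one_smul Gᵈᵐᵃ f

theorem translate_mul (g h : G) (f : Lp ℝ 2 μ) :
    translate μ (g * h) f = translate μ h (translate μ g f) :=
  mul_smul (mk h) (mk g) f

theorem continuous_translate (f : Lp ℝ 2 μ) : Continuous fun g => translate μ g f := by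
  have : Fact ((2 : ENNReal) ≠ ⊤) := ⟨by simp⟩
  have h : Continuous fun g : G => mk g := DomMulAct.continuous_mk
  exact h.smul continuous_const

theorem translate_toLp (g : G) (a : C(G, ℝ)) : translate μ g (ContinuousMap.toLp 2 μ ℝ a) =
    ContinuousMap.toLp 2 μ ℝ (a.comp (ContinuousMap.mulLeft g)) := rfl

theorem kernelOp_translate {F : C(G × G, ℝ)} (hF : ∀ g x y, F (g * x, g * y) = F (x, y)) (g : G)
    (f : Lp ℝ 2 μ) : kernelOp μ F (translate μ g f) = translate μ g (kernelOp μ F f) := by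
  change ContinuousMap.toLp 2 μ ℝ ⟨_, _⟩ = translate μ g (ContinuousMap.toLp 2 μ ℝ ⟨_, _⟩)
  rw [translate_toLp]
  congr 1
  ext x
  change ⟪kernelRow μ F x, translate μ g f⟫ = ⟪kernelRow μ F (g * x), f⟫
  have h : kernelRow μ F x = translate μ g (kernelRow μ F (g * x)) := by
    rw [kernelRow_apply, kernelRow_apply, translate_toLp]
    congr 1
    ext y
    exact (hF g x y).symm
  rw [h, LinearIsometry.inner_map_map]

theorem translate_mem_eigenspace {F : C(G × G, ℝ)} (hF : ∀ g x y, F (g * x, g * y) = F (x, y))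
    (g : G) {c : ℝ} {f : Lp ℝ 2 μ} (hf : f ∈ End.eigenspace (kernelOp μ F : End ℝ (Lp ℝ 2 μ)) c) :
    translate μ g f ∈ End.eigenspace (kernelOp μ F : End ℝ (Lp ℝ 2 μ)) c := by
  rw [End.mem_eigenspace_iff] at hf ⊢
  change kernelOp μ F f = c • f at hf
  change kernelOp μ F (translate μ g f) = c • translate μ g f
  rw [kernelOp_translate μ hF, hf, map_smul]

/-- A nontrivial group element acts nontrivially on some finite-dimensional invariant subspace. -/
theorem exists_translate_ne {g : G} (hg : g ≠ 1) :
    ∃ W : Submodule ℝ (Lp ℝ 2 μ), FiniteDimensional ℝ W ∧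
      (∀ h, ∀ w ∈ W, translate μ h w ∈ W) ∧ ∃ w ∈ W, translate μ g w ≠ w := by
  by_contra! hW
  obtain ⟨k, hk1, hkg, hk⟩ : ∃ k : C(G, ℝ), k 1 ≠ 0 ∧ k g = 0 ∧ ∀ x, k x⁻¹ = k x := by
    obtain ⟨a, ha0, ha1, ha⟩ := exists_continuous_zero_one_of_isClosed (s := {g, g⁻¹}) (t := {1})
      (Set.toFinite _).isClosed isClosed_singleton (by simpa [eq_comm] using hg)
    refine ⟨⟨fun x => a x + a x⁻¹, by fun_prop⟩, ?_, ?_, fun x => ?_⟩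
    · have : a 1 = 1 := ha1 rfl
      simp [this]
    · have h1 : a g = 0 := ha0 (by simp)
      have h2 : a g⁻¹ = 0 := ha0 (by simp)
      simp [h1, h2]
    · simp [add_comm]
  let F : C(G × G, ℝ) := ⟨fun x => k (x.1⁻¹ * x.2), by fun_prop⟩
  have hF : ∀ g x y, F (g * x, g * y) = F (x, y) := fun g x y => by simp [F, mul_assoc]
  have hFs : ∀ x y, F (x, y) = F (y, x) := fun x y => by
    change k (x⁻¹ * y) = k (y⁻¹ * x)
    rw [← hk, mul_inv_rev, inv_inv]
  have hc := isCompactOperator_kernelOp μ F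
  have hbot := ContinuousLinearMap.orthogonalComplement_iSup_eigenspaces_eq_bot hc
    (isSymmetric_kernelOp μ hFs)
  let D : Lp ℝ 2 μ →L[ℝ] Lp ℝ 2 μ :=
    (kernelOp μ F).comp ((translate μ g).toContinuousLinearMap - ContinuousLinearMap.id ℝ _)
  have hD : ∀ f, D f = kernelOp μ F (translate μ g f) - kernelOp μ F f := fun f => by
    simp [D]
  have hDker : (⨆ c, End.eigenspace (kernelOp μ F : End ℝ (Lp ℝ 2 μ)) c) ≤
      LinearMap.ker (D : Lp ℝ 2 μ →ₗ[ℝ] Lp ℝ 2 μ) := by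
    refine iSup_le fun c f hf => ?_
    change D f = 0
    rw [hD, sub_eq_zero]
    rcases eq_or_ne c 0 with rfl | hc0
    · rw [kernelOp_translate μ hF]
      rw [End.mem_eigenspace_iff, zero_smul] at hf
      change kernelOp μ F f = 0 at hf
      rw [hf, map_zero]
    · rw [hW _ (ContinuousLinearMap.finite_dimensional_eigenspace hc c hc0)
        (fun h w hw => translate_mem_eigenspace μ hF h hw) f hf]
  have hD0 : ∀ f, D f = 0 := by
    intro f
    have hcl := Submodule.topologicalClosure_eq_top_iff.2 hbot
    have hle := Submodule.topologicalClosure_minimal _ hDker D.isClosed_ker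
    exact hle (hcl ▸ Submodule.mem_top)
  set u := ContinuousMap.toLp 2 μ ℝ k with hu
  have h1 : ⟪u, translate μ g u⟫ = ⟪u, u⟫ := by
    have h := hD0 u
    rw [hD, sub_eq_zero] at h
    have h' := BoundedContinuousFunction.toLp_injective (p := 2) μ (𝕜 := ℝ) h
    have h2 := DFunLike.congr_fun h' 1
    have hrow : kernelRow μ F 1 = u := by
      rw [kernelRow_apply, hu]
      congr 1
      ext y
      simp [F]
    change ⟪kernelRow μ F 1, translate μ g u⟫ = ⟪kernelRow μ F 1, u⟫ at h2
    rwa [hrow] at h2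
  have h2 : translate μ g u = u := by
    have h3 : ‖u - translate μ g u‖ * ‖u - translate μ g u‖ = 0 := by
      rw [norm_sub_mul_self_real, h1, real_inner_self_eq_norm_mul_norm, LinearIsometry.norm_map]
      ring
    exact (sub_eq_zero.1 (norm_eq_zero.1 (mul_self_eq_zero.1 h3))).symm
  rw [hu, translate_toLp] at h2
  have h4 := DFunLike.congr_fun (ContinuousMap.toLp_injective (p := 2) μ (𝕜 := ℝ) h2) 1
  simp only [ContinuousMap.comp_apply, ContinuousMap.coe_mulLeft, mul_one, hkg] at h4
  exact hk1 h4.symm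

end Translation

section FaithfulRepresentation

open MeasureTheory

universe w

section

variable {G : Type w} [Group G] [TopologicalSpace G] [IsTopologicalGroup G] [CompactSpace G]
  [T2Space G] [MeasurableSpace G] [BorelSpace G] (μ : Measure G) [μ.IsHaarMeasure] [μ.Regular]

/-- The representation on an invariant subspace of `L²`. -/
noncomputable def subRep (W : Submodule ℝ (Lp ℝ 2 μ)) (hW : ∀ h, ∀ w ∈ W, translate μ h w ∈ W) :
    G →* (W →L[ℝ] W) where
  toFun g := ((translate μ g⁻¹).toContinuousLinearMap.comp W.subtypeL).codRestrict W
    fun w => hW _ w w.2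
  map_one' := by
    ext w : 2
    change translate μ 1⁻¹ (w : Lp ℝ 2 μ) = w
    rw [inv_one, translate_one]
  map_mul' g h := by
    ext w : 2
    change translate μ (g * h)⁻¹ (w : Lp ℝ 2 μ) = translate μ g⁻¹ (translate μ h⁻¹ w)
    rw [mul_inv_rev, translate_mul]

theorem subRep_apply (W : Submodule ℝ (Lp ℝ 2 μ)) (hW : ∀ h, ∀ w ∈ W, translate μ h w ∈ W) (g : G)
    (w : W) : (subRep μ W hW g w : Lp ℝ 2 μ) = translate μ g⁻¹ w := rfl

theorem continuous_subRep (W : Submodule ℝ (Lp ℝ 2 μ)) [FiniteDimensional ℝ W]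
    (hW : ∀ h, ∀ w ∈ W, translate μ h w ∈ W) : Continuous (subRep μ W hW) := by
  rw [continuous_clm_apply]
  exact fun w => continuous_induced_rng.2 ((continuous_translate μ (w : Lp ℝ 2 μ)).comp
    continuous_inv)

theorem subRep_eq_one_iff (W : Submodule ℝ (Lp ℝ 2 μ)) (hW : ∀ h, ∀ w ∈ W, translate μ h w ∈ W)
    (g : G) : subRep μ W hW g = 1 ↔ ∀ w ∈ W, translate μ g w = w := by
  have h : subRep μ W hW g = 1 ↔ subRep μ W hW g⁻¹ = 1 := by
    rw [← MonoidHom.mem_ker, ← MonoidHom.mem_ker, inv_mem_iff]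
  rw [h, ContinuousLinearMap.ext_iff]
  constructor
  · intro h w hw
    have := congrArg Subtype.val (h ⟨w, hw⟩)
    rwa [subRep_apply, inv_inv] at this
  · intro h w
    ext1
    rw [subRep_apply, inv_inv]
    exact h w w.2

theorem isClosed_ker_subRep (W : Submodule ℝ (Lp ℝ 2 μ)) (hW : ∀ h, ∀ w ∈ W, translate μ h w ∈ W) :
    IsClosed ((subRep μ W hW).ker : Set G) := by
  have h : ((subRep μ W hW).ker : Set G) = ⋂ w ∈ W, {g | translate μ g w = w} := by
    ext g
    rw [SetLike.mem_coe, MonoidHom.mem_ker, subRep_eq_one_iff, mem_iInter₂]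
    rfl
  rw [h]
  exact isClosed_biInter fun w _ => isClosed_eq (continuous_translate μ w) continuous_const

theorem exists_faithful_rep_of_isHaarMeasure (μ : Measure G) [μ.IsHaarMeasure]
    [μ.Regular] [Nontrivial G]
    (hN : ∀ N : Subgroup G, N.Normal → IsClosed (N : Set G) → N ≠ ⊤ → Finite N) :
    ∃ (A : Type w) (_ : NormedRing A) (_ : NormedAlgebra ℝ A) (ρ : G →* A),
      CompleteSpace A ∧ FiniteDimensional ℝ A ∧ Continuous ρ ∧ Function.Injective ρ := by
  have hsep : ∀ g : G, ∃ W : Submodule ℝ (Lp ℝ 2 μ), FiniteDimensional ℝ W ∧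
      (∀ h, ∀ w ∈ W, translate μ h w ∈ W) ∧ (g ≠ 1 → ∃ w ∈ W, translate μ g w ≠ w) := by
    intro g
    by_cases hg : g = 1
    · refine ⟨⊥, inferInstance, fun h w hw => ?_, fun h => (h hg).elim⟩
      rw [Submodule.mem_bot] at hw ⊢
      rw [hw, map_zero]
    · obtain ⟨W, h1, h2, h3⟩ := exists_translate_ne μ hg
      exact ⟨W, h1, h2, fun _ => h3⟩
  choose W hWfin hW hWne using hsep
  obtain ⟨g₀, hg₀⟩ := exists_ne (1 : G)
  have hfin : Finite (subRep μ (W g₀) (hW g₀)).ker := by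
    refine hN _ inferInstance ?_ fun h => ?_
    · exact isClosed_ker_subRep μ (W g₀) (hW g₀)
    · obtain ⟨w, hw, hne⟩ := hWne g₀ hg₀
      have : g₀ ∈ (subRep μ (W g₀) (hW g₀)).ker := h ▸ Subgroup.mem_top _
      exact hne ((subRep_eq_one_iff μ _ _ _).1 this w hw)
  let V : Submodule ℝ (Lp ℝ 2 μ) := W g₀ ⊔ ⨆ g : (subRep μ (W g₀) (hW g₀)).ker, W g
  have hVfin : FiniteDimensional ℝ V := by
    have := hWfin
    infer_instance
  have hV : ∀ h, ∀ w ∈ V, translate μ h w ∈ V := by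
    intro h
    change V ≤ V.comap (translate μ h).toLinearMap
    refine sup_le (fun w hw => ?_) (iSup_le fun g w hw => ?_)
    · exact (le_sup_left : W g₀ ≤ V) (hW _ h w hw)
    · exact ((le_iSup (fun g : (subRep μ (W g₀) (hW g₀)).ker => W g) g).trans
        le_sup_right : W g ≤ V) (hW _ h w hw)
  refine ⟨V →L[ℝ] V, inferInstance, inferInstance, subRep μ V hV, inferInstance, inferInstance,
    continuous_subRep μ V hV, (injective_iff_map_eq_one _).2 fun g hg => ?_⟩
  rw [subRep_eq_one_iff] at hg
  have hker : g ∈ (subRep μ (W g₀) (hW g₀)).ker :=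
    (subRep_eq_one_iff μ _ _ _).2 fun w hw => hg w ((le_sup_left : W g₀ ≤ V) hw)
  by_contra hg1
  obtain ⟨w, hw, hne⟩ := hWne g hg1
  exact hne (hg w (((le_iSup (fun g : (subRep μ (W g₀) (hW g₀)).ker => W g) ⟨g, hker⟩).trans
    le_sup_right : W g ≤ V) hw))

end

/-- A nontrivial compact group whose proper closed normal subgroups are finite is linear. -/
theorem exists_faithful_rep (G : Type w) [Group G] [TopologicalSpace G] [IsTopologicalGroup G]
    [CompactSpace G] [T2Space G] [Nontrivial G]
    (hN : ∀ N : Subgroup G, N.Normal → IsClosed (N : Set G) → N ≠ ⊤ → Finite N) :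
    ∃ (A : Type w) (_ : NormedRing A) (_ : NormedAlgebra ℝ A) (ρ : G →* A),
      CompleteSpace A ∧ FiniteDimensional ℝ A ∧ Continuous ρ ∧ Function.Injective ρ := by
  let : MeasurableSpace G := borel G
  have : BorelSpace G := ⟨rfl⟩
  exact exists_faithful_rep_of_isHaarMeasure (Measure.haar : Measure G) hN

end FaithfulRepresentation

end SimpleLie

/-- Every product (over an arbitrary index set) of simple, connected and simply
connected compact Lie groups is an AE(3)-compactum. -/
theorem prod_simple_scsc_Lie_groups_isAE3 (T : Type u) (L : T → CompactGroupPkg.{u})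
    (hL : ∀ t, IsSimpleSCSCLieGroup (L t)) :
    IsAE 3 (∀ t, (L t).carrier) := by
  intro Z _ _ _ hZ Z₀ hZ₀ g₀
  have hex : ∀ t, ∃ f : C(Z, (L t).carrier), ∀ z : Z₀, f z = g₀ z t := by
    intro t
    obtain ⟨-, -, hsc, ⟨a, b, hab⟩, hN⟩ := hL t
    have : Nontrivial (L t).carrier := ⟨a * b, b * a, hab⟩
    obtain ⟨A, _, _, ρ, _, _, hρ, hinj⟩ := SimpleLie.exists_faithful_rep (L t).carrier hN
    let g : C(Z₀, (L t).carrier) := ⟨fun z => g₀ z t, by fun_prop⟩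
    exact SimpleLie.exists_extension_of_covDimLE hρ hinj hZ hZ₀ g
  choose f hf using hex
  exact ⟨⟨fun z t => f t z, by fun_prop⟩, fun z => funext fun t => hf t z⟩
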